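/- arXiv:1912.04215 — 2 statements merged into one kernel-verified Lean document; each statement's English description precedes it below -/
import Mathlib

section
/- There exist a constant C_2 ∈ (0,∞) and δ_0 ∈ (0,1) such that for every n ∈ ℕ with δ = T/n ∈ (0,δ_0), every k ∈ {1,…,m}, and every s ∈ [0,T), it holds that ∫_s^T P(Z_k^s ∩ Z_k^t) dt ≤ C_2 δ^{1/2} · ( P(Z_k^s) + E[ 1_{Z_k^s} · (X^{(δ)}_{s̲+δ} − ζ_k)^2 ] ). -/
open MeasureTheory ProbabilityTheory

/-- Grid values of the Euler–Maruyama scheme with step size `δ` and initial value `x`. -/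
noncomputable def emGrid {Ω : Type*} (μ σ ρ : ℝ → ℝ) (W N : ℝ → Ω → ℝ)
    (δ : ℝ) (x : ℝ) : ℕ → Ω → ℝ
  | 0, _ => x
  | (j + 1), ω =>
      emGrid μ σ ρ W N δ x j ω
        + μ (emGrid μ σ ρ W N δ x j ω) * δ
        + σ (emGrid μ σ ρ W N δ x j ω) * (W (((j : ℝ) + 1) * δ) ω - W ((j : ℝ) * δ) ω)
        + ρ (emGrid μ σ ρ W N δ x j ω) * (N (((j : ℝ) + 1) * δ) ω - N ((j : ℝ) * δ) ω)

/-- The last grid point `t̲ = δ ⌊t/δ⌋` before time `t`. -/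
noncomputable def lastGrid (δ t : ℝ) : ℝ := (⌊t / δ⌋.toNat : ℝ) * δ

/-- The continuous-time Euler–Maruyama scheme
`X_t = X_t̲ + μ(X_t̲)(t - t̲) + σ(X_t̲)(W_t - W_t̲) + ρ(X_t̲)(N_t - N_t̲)`. -/
noncomputable def emProc {Ω : Type*} (μ σ ρ : ℝ → ℝ) (W N : ℝ → Ω → ℝ)
    (δ : ℝ) (x : ℝ) (t : ℝ) (ω : Ω) : ℝ :=
  emGrid μ σ ρ W N δ x (⌊t / δ⌋.toNat) ω
    + μ (emGrid μ σ ρ W N δ x (⌊t / δ⌋.toNat) ω) * (t - lastGrid δ t)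
    + σ (emGrid μ σ ρ W N δ x (⌊t / δ⌋.toNat) ω) * (W t ω - W (lastGrid δ t) ω)
    + ρ (emGrid μ σ ρ W N δ x (⌊t / δ⌋.toNat) ω) * (N t ω - N (lastGrid δ t) ω)

/-- The event `Z_k^t` that the Euler–Maruyama process at times `t̲` and `t` lies on
different sides of the point `ζk` (i.e. `(X_t̲ - ζk)(X_t - ζk) ≤ 0`). -/
def crossEvent {Ω : Type*} (μ σ ρ : ℝ → ℝ) (W N : ℝ → Ω → ℝ)
    (δ x ζk t : ℝ) : Set Ω :=
  {ω | (emProc μ σ ρ W N δ x (lastGrid δ t) ω - ζk) * (emProc μ σ ρ W N δ x t ω - ζk) ≤ 0}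


lemma aux_freeze {Ω : Type*} (m : MeasurableSpace Ω) {m0 : MeasurableSpace Ω} (P : Measure Ω)
    [IsProbabilityMeasure P] (hm : m ≤ m0) (X : Ω → ℝ) (hX : Measurable[m] X)
    (V : Ω → ℝ × ℝ) (hV : Measurable V)
    (hind : Indep (MeasurableSpace.comap V inferInstance) m P)
    (A : Set Ω) (hA : MeasurableSet[m] A) (f : ℝ × (ℝ × ℝ) → ENNReal) (hf : Measurable f) :
    ∫⁻ ω in A, f (X ω, V ω) ∂P = ∫⁻ ω in A, (∫⁻ ω', f (X ω, V ω') ∂P) ∂P := by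
  have hX0 : Measurable X := hX.mono hm le_rfl
  have hA0 : MeasurableSet A := hm _ hA
  have key : ((P.restrict A).map X).prod (P.map V) = (P.restrict A).map (fun ω => (X ω, V ω)) := by
    have : IsProbabilityMeasure (P.map V) := Measure.isProbabilityMeasure_map hV.aemeasurable
    apply Measure.prod_eq
    intro s t hs ht
    rw [Measure.map_apply (hX0.prodMk hV) (hs.prod ht), Measure.map_apply hX0 hs,
      Measure.map_apply hV ht, Measure.restrict_apply (hX0 hs),
      Measure.restrict_apply ((hX0.prodMk hV) (hs.prod ht))]
    have h := (Indep_iff _ _ P).1 hind (V ⁻¹' t) (X ⁻¹' s ∩ A) ⟨t, ht, rfl⟩ ((hX hs).inter hA)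
    rw [mul_comm, ← h]
    congr 1
    ext ω
    simp only [Set.mem_inter_iff, Set.mem_preimage, Set.mem_prod]
    tauto
  have h1 : ∫⁻ ω in A, f (X ω, V ω) ∂P
      = ∫⁻ z, f z ∂((P.restrict A).map (fun ω => (X ω, V ω))) := by
    rw [lintegral_map hf (hX0.prodMk hV)]
  rw [h1, ← key, lintegral_prod _ hf.aemeasurable, lintegral_map _ hX0]
  · refine lintegral_congr fun ω => ?_
    exact lintegral_map (f := fun v => f (X ω, v)) (hf.comp measurable_prodMk_left) hV
  · exact hf.lintegral_prod_right'

lemma aux_lin_of_lip (f : ℝ → ℝ) (S : Set ℝ) (h : ∃ K : NNReal, LipschitzOnWith K f S) :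
    ∃ L : ℝ, ∀ x ∈ S, |f x| ≤ L * (1 + |x|) := by
  obtain ⟨K, hK⟩ := h
  rcases S.eq_empty_or_nonempty with rfl | ⟨z, hz⟩
  · exact ⟨0, by simp⟩
  · refine ⟨|f z| + K * (1 + |z|), fun x hx => ?_⟩
    have h1 := hK.dist_le_mul x hx z hz
    rw [Real.dist_eq, Real.dist_eq] at h1
    have h2 : |f x| ≤ |f z| + |f x - f z| := by
      have := abs_add_le (f z) (f x - f z); simpa using this
    have h3 : |x - z| ≤ |x| + |z| := abs_sub _ _
    have hK0 : (0:ℝ) ≤ K := K.2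
    nlinarith [abs_nonneg (f z), abs_nonneg x, abs_nonneg z, mul_nonneg (abs_nonneg (f z)) (abs_nonneg x),
      mul_nonneg hK0 (mul_nonneg (abs_nonneg x) (abs_nonneg z)), mul_le_mul_of_nonneg_left h3 hK0]

lemma aux_lin_union (f : ℝ → ℝ) (S U : Set ℝ) (hS : ∃ L : ℝ, ∀ x ∈ S, |f x| ≤ L * (1 + |x|))
    (hU : ∃ L : ℝ, ∀ x ∈ U, |f x| ≤ L * (1 + |x|)) :
    ∃ L : ℝ, ∀ x ∈ S ∪ U, |f x| ≤ L * (1 + |x|) := by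
  obtain ⟨L, hL⟩ := hS
  obtain ⟨M, hM⟩ := hU
  refine ⟨max L M, fun x hx => ?_⟩
  have h0 : 0 ≤ 1 + |x| := by positivity
  rcases hx with hx | hx
  · exact (hL x hx).trans (mul_le_mul_of_nonneg_right (le_max_left _ _) h0)
  · exact (hM x hx).trans (mul_le_mul_of_nonneg_right (le_max_right _ _) h0)

lemma aux_lin_singleton (f : ℝ → ℝ) (z : ℝ) :
    ∃ L : ℝ, ∀ x ∈ ({z} : Set ℝ), |f x| ≤ L * (1 + |x|) := by
  refine ⟨|f z|, fun x hx => ?_⟩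
  rw [Set.mem_singleton_iff] at hx
  subst hx
  nlinarith [abs_nonneg (f x), abs_nonneg x, mul_nonneg (abs_nonneg (f x)) (abs_nonneg x)]

lemma aux_lin_mono (f : ℝ → ℝ) (S U : Set ℝ) (hSU : S ⊆ U)
    (hU : ∃ L : ℝ, ∀ x ∈ U, |f x| ≤ L * (1 + |x|)) :
    ∃ L : ℝ, ∀ x ∈ S, |f x| ≤ L * (1 + |x|) := by
  obtain ⟨M, hM⟩ := hU
  exact ⟨M, fun x hx => hM x (hSU hx)⟩

lemma aux_mu_lin (μ : ℝ → ℝ) (m : ℕ) (hm : 0 < m) (ζ : Fin m → ℝ)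
    (hμ_low : ∃ K : NNReal, LipschitzOnWith K μ (Set.Iio (ζ ⟨0, hm⟩)))
    (hμ_high : ∃ K : NNReal, LipschitzOnWith K μ (Set.Ioi (ζ ⟨m - 1, Nat.sub_lt hm one_pos⟩)))
    (hμ_mid : ∀ (k : Fin m) (h : (k : ℕ) + 1 < m),
      ∃ K : NNReal, LipschitzOnWith K μ (Set.Ioo (ζ k) (ζ ⟨(k : ℕ) + 1, h⟩))) :
    ∃ L : ℝ, ∀ x, |μ x| ≤ L * (1 + |x|) := by
  have key : ∀ (k : ℕ) (hk : k < m), ∃ L : ℝ, ∀ x ∈ Set.Iic (ζ ⟨k, hk⟩), |μ x| ≤ L * (1 + |x|) := by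
    intro k
    induction k with
    | zero =>
      intro hk
      refine aux_lin_mono μ _ _ ?_ (aux_lin_union μ _ _ (aux_lin_of_lip μ _ hμ_low)
        (aux_lin_singleton μ (ζ ⟨0, hm⟩)))
      intro x hx
      rcases lt_or_eq_of_le (Set.mem_Iic.1 hx) with h | h
      · exact Or.inl h
      · exact Or.inr h
    | succ k ih =>
      intro hk
      refine aux_lin_mono μ _ _ ?_ (aux_lin_union μ _ _ (aux_lin_union μ _ _
        (ih (by omega)) (aux_lin_of_lip μ _ (hμ_mid ⟨k, by omega⟩ hk)))
        (aux_lin_singleton μ (ζ ⟨k+1, hk⟩)))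
      intro x hx
      rcases lt_or_eq_of_le (Set.mem_Iic.1 hx) with h | h
      · rcases le_or_gt x (ζ ⟨k, by omega⟩) with h' | h'
        · exact Or.inl (Or.inl h')
        · exact Or.inl (Or.inr ⟨h', h⟩)
      · exact Or.inr h
  obtain ⟨L, hL⟩ := aux_lin_union μ _ _ (key (m-1) (by omega)) (aux_lin_of_lip μ _ hμ_high)
  refine ⟨L, fun x => hL x ?_⟩
  rcases le_or_gt x (ζ ⟨m-1, by omega⟩) with h' | h'
  · exact Or.inl h'
  · exact Or.inr h'

/-- recentering of linear growth -/
lemma aux_lin_center (f : ℝ → ℝ) (z : ℝ) (h : ∃ L : ℝ, ∀ x, |f x| ≤ L * (1 + |x|)) :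
    ∃ L : ℝ, 0 ≤ L ∧ ∀ x, |f x| ≤ L * (1 + |x - z|) := by
  obtain ⟨L, hL⟩ := h
  have hL0 : 0 ≤ L := by
    have := (abs_nonneg _).trans (hL 0)
    simpa using this
  refine ⟨L * (1 + |z|), by positivity, fun x => (hL x).trans ?_⟩
  have h1 : |x| ≤ |x - z| + |z| := by
    have := abs_add_le (x - z) z; simpa using this
  have h2 : 1 + |x| ≤ (1 + |z|) * (1 + |x - z|) := by
    nlinarith [mul_nonneg (abs_nonneg z) (abs_nonneg (x - z))]
  rw [mul_assoc]
  exact mul_le_mul_of_nonneg_left h2 hL0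

lemma aux_lin_lipschitz (f : ℝ → ℝ) (h : ∃ K : NNReal, LipschitzWith K f) :
    ∃ L : ℝ, ∀ x, |f x| ≤ L * (1 + |x|) := by
  obtain ⟨K, hK⟩ := h
  obtain ⟨L, hL⟩ := aux_lin_of_lip f Set.univ ⟨K, hK.lipschitzOnWith⟩
  exact ⟨L, fun x => hL x (Set.mem_univ x)⟩

/-- Nondegeneracy of `σ` near `z`. -/
lemma aux_sigma_low (σ : ℝ → ℝ) (z : ℝ) (h : ∃ K : NNReal, LipschitzWith K σ) (hz : σ z ≠ 0) :
    ∃ ε c : ℝ, 0 < ε ∧ 0 < c ∧ ∀ x, |x - z| ≤ ε → c ≤ |σ x| := by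
  obtain ⟨K, hK⟩ := h
  have hpos : 0 < |σ z| := abs_pos.2 hz
  have hK0 : (0:ℝ) ≤ K := K.2
  refine ⟨|σ z| / (2 * (K + 1)), |σ z| / 2, by positivity, by positivity, fun x hx => ?_⟩
  have h1 := hK.dist_le_mul x z
  rw [Real.dist_eq, Real.dist_eq] at h1
  have h2 : |σ z| ≤ |σ x| + |σ x - σ z| := by
    have := abs_sub (σ x) (σ x - σ z); simpa using this
  have h3 : (K:ℝ) * |x - z| ≤ |σ z| / 2 := by
    calc (K:ℝ) * |x - z| ≤ K * (|σ z| / (2 * (K + 1))) := mul_le_mul_of_nonneg_left hx hK0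
      _ ≤ |σ z| / 2 := by
        rw [mul_div_assoc', div_le_div_iff₀ (by positivity) (by positivity)]
        nlinarith
  linarith

/-- second-order lower bound for `√(δ + y²)`. -/
lemma aux_sqrt_lower (δ y w : ℝ) (hδ : 0 < δ) :
    √(δ + y ^ 2) + y / √(δ + y ^ 2) * w
      + w ^ 2 * δ / (2 * (δ + y ^ 2) * (√(δ + y ^ 2) + |w|)) ≤ √(δ + (y + w) ^ 2) := by
  have hD : 0 < δ + y ^ 2 := by positivity
  have hE : 0 < δ + (y + w) ^ 2 := by positivity
  set S := √(δ + y ^ 2) with hS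
  set R := √(δ + (y + w) ^ 2) with hR
  have hS0 : 0 < S := Real.sqrt_pos.2 hD
  have hR0 : 0 < R := Real.sqrt_pos.2 hE
  have hS2 : S ^ 2 = δ + y ^ 2 := Real.sq_sqrt hD.le
  have hR2 : R ^ 2 = δ + (y + w) ^ 2 := Real.sq_sqrt hE.le
  have hyS : |y| ≤ S := by
    apply Real.abs_le_sqrt; linarith
  have hRS : R ≤ S + |w| := by
    apply Real.sqrt_le_iff.2
    refine ⟨by positivity, ?_⟩
    have : y * w ≤ S * |w| := by
      calc y * w ≤ |y * w| := le_abs_self _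
        _ = |y| * |w| := abs_mul _ _
        _ ≤ S * |w| := mul_le_mul_of_nonneg_right hyS (abs_nonneg _)
    nlinarith [sq_abs w]
  set B := S + y / S * w with hB
  have hyS1 : |y / S * w| ≤ |w| := by
    rw [abs_mul, abs_div, abs_of_pos hS0]
    have : |y| / S ≤ 1 := (div_le_one hS0).2 hyS
    nlinarith [abs_nonneg w]
  have hprod : (R - B) * (R + B) = w ^ 2 * δ / (δ + y ^ 2) := by
    have : (R - B) * (R + B) = R ^ 2 - B ^ 2 := by ring
    rw [this, hR2, hB, ← hS2]
    have : (S + y / S * w) ^ 2 = S ^ 2 + 2 * y * w + y ^ 2 * w ^ 2 / S ^ 2 := by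
      field_simp
      ring
    rw [this]
    have hδ' : δ = S ^ 2 - y ^ 2 := by linarith
    rw [hδ']
    field_simp
    ring
  have hprod0 : 0 ≤ (R - B) * (R + B) := by rw [hprod]; positivity
  have hBle : R + B ≤ 2 * (S + |w|) := by
    have := (abs_le.1 hyS1).2
    linarith
  have hRB : 0 ≤ R - B := by
    by_contra hcon
    push Not at hcon
    have : 0 < R + B := by linarith
    nlinarith
  have hfin : w ^ 2 * δ / (2 * (δ + y ^ 2) * (S + |w|)) ≤ R - B := by
    rw [div_le_iff₀ (by positivity)]
    have h1 : w ^ 2 * δ = (R - B) * (R + B) * (δ + y ^ 2) := by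
      rw [hprod]; field_simp
    rw [h1]
    have h2 : (R - B) * (R + B) ≤ (R - B) * (2 * (S + |w|)) := mul_le_mul_of_nonneg_left hBle hRB
    have := mul_le_mul_of_nonneg_right h2 hD.le
    linarith
  linarith
lemma aux_poisson_hasSum (r : ℝ) :
    HasSum (fun n : ℕ => Real.exp (-r) * r ^ n / (n.factorial : ℝ) * (n:ℝ) ^ 2) (r + r ^ 2) := by
  have h0 : HasSum (fun n : ℕ => Real.exp (-r) * r ^ n / (n.factorial : ℝ)) 1 := by
    have := (NormedSpace.expSeries_div_hasSum_exp (r : ℝ)).mul_left (Real.exp (-r))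
    rw [← Real.exp_eq_exp_ℝ, ← Real.exp_add] at this
    simpa [mul_div_assoc] using this
  have h1 : HasSum (fun n : ℕ => Real.exp (-r) * r ^ n / (n.factorial : ℝ) * (n:ℝ)) r := by
    rw [← hasSum_nat_add_iff' 1]
    have h := h0.mul_left r
    have e : (fun n : ℕ => Real.exp (-r) * r ^ (n + 1) / ((n + 1).factorial : ℝ) * ((n + 1 : ℕ):ℝ))
        = fun n : ℕ => r * (Real.exp (-r) * r ^ n / (n.factorial : ℝ)) := by
      funext n
      rw [Nat.factorial_succ]
      have : (n.factorial : ℝ) ≠ 0 := by positivity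
      push_cast
      field_simp
      ring
    rw [e]
    simpa using h
  rw [← hasSum_nat_add_iff' 1]
  have h := (h1.add h0).mul_left r
  have e : (fun n : ℕ => Real.exp (-r) * r ^ (n + 1) / ((n + 1).factorial : ℝ)
      * ((n + 1 : ℕ):ℝ) ^ 2)
      = fun n : ℕ => r * (Real.exp (-r) * r ^ n / (n.factorial : ℝ) * (n:ℝ)
        + Real.exp (-r) * r ^ n / (n.factorial : ℝ)) := by
    funext n
    rw [Nat.factorial_succ]
    have : (n.factorial : ℝ) ≠ 0 := by positivity
    push_cast
    field_simp
    ring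
  rw [e]
  have e2 : r + r ^ 2 - ∑ i ∈ Finset.range 1, Real.exp (-r) * r ^ i / (i.factorial : ℝ) * (i:ℝ) ^ 2
      = r * (r + 1) := by
    simp; ring
  rw [e2]
  exact h

lemma aux_poisson {Ω : Type*} {m0 : MeasurableSpace Ω} (P : Measure Ω)
    (N : Ω → ℝ) (hNm : Measurable N) (r : NNReal)
    (hN : P.map N = Measure.map (fun k : ℕ => (k : ℝ)) (poissonMeasure r)) :
    Integrable (fun ω => N ω ^ 2) P ∧ ∫ ω, N ω ^ 2 ∂P = r + r ^ 2 ∧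
      ∀ᵐ ω ∂P, N ω = 0 ∨ 1 ≤ N ω := by
  have hs := aux_poisson_hasSum (r : ℝ)
  have hinteg : Integrable (fun n : ℕ => (n:ℝ) ^ 2) (poissonMeasure r) := by
    rw [integrable_poissonMeasure_iff]
    have := hs.summable
    simpa using this
  have hcast : Measurable (fun k : ℕ => (k : ℝ)) := measurable_from_top
  have hsq : Measurable (fun x : ℝ => x ^ 2) := by fun_prop
  refine ⟨?_, ?_, ?_⟩
  · have h1 : Integrable (fun x : ℝ => x ^ 2) (P.map N) := by
      rw [hN, integrable_map_measure hsq.aestronglyMeasurable hcast.aemeasurable]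
      exact hinteg
    exact (integrable_map_measure hsq.aestronglyMeasurable hNm.aemeasurable).1 h1
  · have h1 : ∫ ω, N ω ^ 2 ∂P = ∫ x, x ^ 2 ∂(P.map N) :=
      (integral_map hNm.aemeasurable hsq.aestronglyMeasurable).symm
    rw [h1, hN, integral_map hcast.aemeasurable hsq.aestronglyMeasurable,
      integral_poissonMeasure]
    exact hs.tsum_eq
  · have hset : MeasurableSet {x : ℝ | x = 0 ∨ 1 ≤ x} :=
      (measurableSet_singleton 0).union measurableSet_Ici
    have h1 : ∀ᵐ x ∂(P.map N), x = 0 ∨ 1 ≤ x := by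
      rw [hN, ae_map_iff hcast.aemeasurable hset]
      refine Filter.Eventually.of_forall fun k => ?_
      rcases Nat.eq_zero_or_pos k with h | h
      · left; simp [h]
      · right; exact_mod_cast h
    exact (ae_map_iff hNm.aemeasurable hset).1 h1

lemma aux_gauss_scale (h : ℝ) (hh : 0 ≤ h) :
    gaussianReal 0 (Real.toNNReal h) = (gaussianReal 0 1).map (fun x => √h * x) := by
  rw [gaussianReal_map_const_mul]
  congr 1
  · simp
  · ext
    simp [Real.sq_sqrt hh, hh]

lemma aux_gauss_int (p : ℕ) : Integrable (fun x : ℝ => |x| ^ p) (gaussianReal 0 1) := by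
  have := (memLp_id_gaussianReal (μ := 0) (v := 1) (p : NNReal)).integrable_norm_pow'
  simpa using this

lemma aux_gauss {Ω : Type*} {m0 : MeasurableSpace Ω} (P : Measure Ω)
    (w : Ω → ℝ) (hwm : Measurable w) (h : ℝ) (hh : 0 ≤ h)
    (hw : P.map w = gaussianReal 0 (Real.toNNReal h)) :
    Integrable w P ∧ ∫ ω, w ω ∂P = 0 ∧ Integrable (fun ω => w ω ^ 2) P ∧ ∫ ω, w ω ^ 2 ∂P = h := by
  have hsq : Measurable (fun x : ℝ => x ^ 2) := by fun_prop
  have i1 : Integrable (fun x : ℝ => x) (P.map w) := by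
    rw [hw]
    exact (memLp_id_gaussianReal (μ := 0) (v := Real.toNNReal h) 1).integrable (by simp)
  have i2 : Integrable (fun x : ℝ => x ^ 2) (P.map w) := by
    rw [hw]
    have := (memLp_id_gaussianReal (μ := 0) (v := Real.toNNReal h) 2).integrable_norm_pow
      (by simp)
    simpa using this
  refine ⟨(integrable_map_measure measurable_id.aestronglyMeasurable hwm.aemeasurable).1 i1, ?_,
    (integrable_map_measure hsq.aestronglyMeasurable hwm.aemeasurable).1 i2, ?_⟩
  · have h1 : ∫ ω, w ω ∂P = ∫ x, x ∂(P.map w) :=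
      (integral_map hwm.aemeasurable measurable_id.aestronglyMeasurable).symm
    rw [h1, hw, integral_id_gaussianReal]
  · have h1 : ∫ ω, w ω ^ 2 ∂P = ∫ x, x ^ 2 ∂(P.map w) :=
      (integral_map hwm.aemeasurable hsq.aestronglyMeasurable).symm
    have hv := variance_fun_id_gaussianReal (μ := 0) (v := Real.toNNReal h)
    rw [variance_eq_integral (by fun_prop), integral_id_gaussianReal] at hv
    rw [h1, hw]
    simpa [hh] using hv

/-- cubic moment bounds -/
lemma aux_gauss_cube : ∃ M : ℝ, 0 < M ∧ ∀ {Ω : Type*} {_ : MeasurableSpace Ω} (P : Measure Ω)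
    (w : Ω → ℝ) (_ : Measurable w) (h δ : ℝ) (_ : 0 ≤ h) (_ : h ≤ δ)
    (_ : P.map w = gaussianReal 0 (Real.toNNReal h)),
    ∫⁻ ω, ENNReal.ofReal ((2 * √δ + |w ω|) ^ 3) ∂P ≤ ENNReal.ofReal (M * (δ * √δ)) ∧
    ∫⁻ ω, ENNReal.ofReal ((2 * √δ + |w ω|) ^ 2) ∂P ≤ ENNReal.ofReal (M * δ) := by
  have hinteg : Integrable (fun x : ℝ => (2 + |x|) ^ 3) (gaussianReal 0 1) := by
    have h3 := aux_gauss_int 3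
    have h2 := aux_gauss_int 2
    have h1 := aux_gauss_int 1
    have := (((integrable_const (8:ℝ)).add (h1.const_mul 12)).add (h2.const_mul 6)).add h3
    refine this.congr (Filter.Eventually.of_forall fun x => ?_)
    simp only [Pi.add_apply]
    ring
  refine ⟨∫ x, (2 + |x|) ^ 3 ∂(gaussianReal 0 1) + 1, ?_, ?_⟩
  · have : 0 ≤ ∫ x, (2 + |x|) ^ 3 ∂(gaussianReal 0 1) := integral_nonneg fun x => by positivity
    linarith
  intro Ω m0 P w hwm h δ hh hhδ hw
  have hδ : 0 ≤ δ := hh.trans hhδ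
  have hsδ : √δ ^ 2 = δ := Real.sq_sqrt hδ
  have hle : √h ≤ √δ := Real.sqrt_le_sqrt hhδ
  have hs0 : 0 ≤ √δ := Real.sqrt_nonneg _
  have hbase : ∀ x : ℝ, 2 * √δ + |√h * x| ≤ √δ * (2 + |x|) := by
    intro x
    rw [abs_mul, abs_of_nonneg (Real.sqrt_nonneg h)]
    nlinarith [mul_le_mul_of_nonneg_right hle (abs_nonneg x)]
  have htrans : ∀ f : ℝ → ENNReal, Measurable f →
      ∫⁻ ω, f (w ω) ∂P = ∫⁻ x, f (√h * x) ∂(gaussianReal 0 1) := by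
    intro f hf
    rw [← lintegral_map hf hwm, hw, aux_gauss_scale h hh, lintegral_map hf (by fun_prop)]
  have hMint : ∫⁻ x, ENNReal.ofReal ((2 + |x|) ^ 3) ∂(gaussianReal 0 1)
      = ENNReal.ofReal (∫ x, (2 + |x|) ^ 3 ∂(gaussianReal 0 1)) :=
    (ofReal_integral_eq_lintegral_ofReal hinteg
      (Filter.Eventually.of_forall fun x => by positivity)).symm
  have hI0 : 0 ≤ ∫ x, (2 + |x|) ^ 3 ∂(gaussianReal 0 1) := integral_nonneg fun x => by positivity
  constructor
  · rw [htrans (fun x => ENNReal.ofReal ((2 * √δ + |x|) ^ 3)) (by fun_prop)]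
    calc ∫⁻ x, ENNReal.ofReal ((2 * √δ + |√h * x|) ^ 3) ∂(gaussianReal 0 1)
        ≤ ∫⁻ x, ENNReal.ofReal (δ * √δ) * ENNReal.ofReal ((2 + |x|) ^ 3) ∂(gaussianReal 0 1) := by
          refine lintegral_mono fun x => ?_
          rw [← ENNReal.ofReal_mul (by positivity)]
          apply ENNReal.ofReal_le_ofReal
          calc (2 * √δ + |√h * x|) ^ 3 ≤ (√δ * (2 + |x|)) ^ 3 :=
                pow_le_pow_left₀ (by positivity) (hbase x) 3
            _ = √δ ^ 2 * √δ * (2 + |x|) ^ 3 := by ring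
            _ = _ := by rw [hsδ]
      _ = ENNReal.ofReal (δ * √δ) * ENNReal.ofReal (∫ x, (2 + |x|) ^ 3 ∂(gaussianReal 0 1)) := by
          rw [lintegral_const_mul _ (by fun_prop), hMint]
      _ ≤ _ := by
          rw [← ENNReal.ofReal_mul (by positivity)]
          apply ENNReal.ofReal_le_ofReal
          have : 0 ≤ δ * √δ := by positivity
          nlinarith
  · rw [htrans (fun x => ENNReal.ofReal ((2 * √δ + |x|) ^ 2)) (by fun_prop)]
    calc ∫⁻ x, ENNReal.ofReal ((2 * √δ + |√h * x|) ^ 2) ∂(gaussianReal 0 1)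
        ≤ ∫⁻ x, ENNReal.ofReal δ * ENNReal.ofReal ((2 + |x|) ^ 3) ∂(gaussianReal 0 1) := by
          refine lintegral_mono fun x => ?_
          rw [← ENNReal.ofReal_mul (by positivity)]
          apply ENNReal.ofReal_le_ofReal
          calc (2 * √δ + |√h * x|) ^ 2 ≤ (√δ * (2 + |x|)) ^ 2 :=
                pow_le_pow_left₀ (by positivity) (hbase x) 2
            _ = √δ ^ 2 * (2 + |x|) ^ 2 := by ring
            _ = δ * (2 + |x|) ^ 2 := by rw [hsδ]
            _ ≤ δ * (2 + |x|) ^ 3 := by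
              apply mul_le_mul_of_nonneg_left _ hδ
              apply pow_le_pow_right₀ _ (by norm_num)
              linarith [abs_nonneg x]
      _ = ENNReal.ofReal δ * ENNReal.ofReal (∫ x, (2 + |x|) ^ 3 ∂(gaussianReal 0 1)) := by
          rw [lintegral_const_mul _ (by fun_prop), hMint]
      _ ≤ _ := by
          rw [← ENNReal.ofReal_mul (by positivity)]
          apply ENNReal.ofReal_le_ofReal
          nlinarith

lemma aux_sqrt_le (δ y : ℝ) (hδ : 0 ≤ δ) : √(δ + y ^ 2) ≤ √δ + |y| := by
  apply Real.sqrt_le_iff.2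
  refine ⟨by positivity, ?_⟩
  nlinarith [Real.sq_sqrt hδ, sq_abs y, mul_nonneg (Real.sqrt_nonneg δ) (abs_nonneg y)]

lemma aux_int_sqrt {Ω : Type*} {m0 : MeasurableSpace Ω} (P : Measure Ω) [IsProbabilityMeasure P]
    (w : Ω → ℝ) (hwm : Measurable w) (hwi : Integrable w P) (δ y b : ℝ) (hδ : 0 ≤ δ) :
    Integrable (fun ω => √(δ + (y + b * w ω) ^ 2)) P := by
  have hg : Integrable (fun ω => √δ + |y + b * w ω|) P :=
    (integrable_const _).add (((integrable_const _).add (hwi.const_mul b)).abs)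
  refine hg.mono' (by fun_prop) (Filter.Eventually.of_forall fun ω => ?_)
  rw [Real.norm_of_nonneg (Real.sqrt_nonneg _)]
  exact aux_sqrt_le δ _ hδ

lemma aux_stepW_weak {Ω : Type*} {m0 : MeasurableSpace Ω} (P : Measure Ω) [IsProbabilityMeasure P]
    (w : Ω → ℝ) (hwm : Measurable w) (hwi : Integrable w P) (hw0 : ∫ ω, w ω ∂P = 0)
    (δ y b : ℝ) (hδ : 0 < δ) :
    √(δ + y ^ 2) ≤ ∫ ω, √(δ + (y + b * w ω) ^ 2) ∂P := by
  have h1 : ∫ ω, (√(δ + y ^ 2) + y / √(δ + y ^ 2) * (b * w ω)) ∂P = √(δ + y ^ 2) := by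
    rw [integral_add (integrable_const _) ((hwi.const_mul b).const_mul _),
      integral_const_mul, integral_const_mul, hw0]
    simp
  calc √(δ + y ^ 2) = _ := h1.symm
    _ ≤ _ := by
      apply integral_mono ((integrable_const _).add ((hwi.const_mul b).const_mul _))
        (aux_int_sqrt P w hwm hwi δ y b hδ.le)
      intro ω
      have := aux_sqrt_lower δ y (b * w ω) hδ
      have h2 : 0 ≤ (b * w ω) ^ 2 * δ / (2 * (δ + y ^ 2) * (√(δ + y ^ 2) + |b * w ω|)) := by
        positivity
      simp only [Pi.add_apply]
      linarith

lemma aux_stepW (c : ℝ) (hc : 0 < c) : ∃ κ : ℝ, 0 < κ ∧ ∀ {Ω : Type*} {_ : MeasurableSpace Ω}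
    (P : Measure Ω) [IsProbabilityMeasure P]
    (w : Ω → ℝ) (_ : Measurable w) (δ : ℝ) (_ : 0 < δ)
    (_ : P.map w = gaussianReal 0 (Real.toNNReal δ)) (y b : ℝ) (_ : c ≤ |b|),
    √(δ + y ^ 2) + κ * (δ ^ 2 / ((δ + y ^ 2) * √(δ + y ^ 2)))
      ≤ ∫ ω, √(δ + (y + b * w ω) ^ 2) ∂P := by
  set f : ℝ → ℝ := fun x => c ^ 2 * x ^ 2 / (2 * (1 + c * |x|)) with hf
  have hf0 : ∀ x, 0 ≤ f x := fun x => by simp only [hf]; positivity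
  have hfm : Measurable f := by simp only [hf]; fun_prop
  have hfi : Integrable f (gaussianReal 0 1) := by
    refine ((aux_gauss_int 2).const_mul (c ^ 2)).mono' hfm.aestronglyMeasurable
      (Filter.Eventually.of_forall fun x => ?_)
    rw [Real.norm_of_nonneg (hf0 x), sq_abs]
    simp only [hf]
    apply div_le_self (by positivity)
    have : 0 ≤ c * |x| := by positivity
    linarith
  refine ⟨∫ x, f x ∂(gaussianReal 0 1), ?_, ?_⟩
  · rw [integral_pos_iff_support_of_nonneg hf0 hfi]
    have hsupp : Function.support f = {0}ᶜ := by
      ext x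
      simp only [Function.mem_support, Set.mem_compl_iff, Set.mem_singleton_iff]
      constructor
      · rintro h rfl; apply h; simp [hf]
      · intro h; simp only [hf]
        have : 0 < x ^ 2 := by positivity
        positivity
    have := nullSingletonClass_gaussianReal (μ := 0) (v := 1) (by simp)
    rw [hsupp, prob_compl_eq_one_sub (measurableSet_singleton 0), measure_singleton]
    simp
  intro Ω m0 P _ w hwm δ hδ hw y b hb
  obtain ⟨hwi, hw0, -, -⟩ := aux_gauss P w hwm δ hδ.le hw
  set S := √(δ + y ^ 2) with hS
  have hD : 0 < δ + y ^ 2 := by positivity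
  have hS0 : 0 < S := Real.sqrt_pos.2 hD
  have hsδ0 : 0 < √δ := Real.sqrt_pos.2 hδ
  have hsδ : √δ ^ 2 = δ := Real.sq_sqrt hδ.le
  have hSδ : √δ ≤ S := Real.sqrt_le_sqrt (by nlinarith [sq_nonneg y])
  have hfd : Measurable (fun x => f (x / √δ)) := hfm.comp (measurable_id.div_const _)
  set A := δ ^ 2 / ((δ + y ^ 2) * S) with hA
  have hA0 : 0 ≤ A := by positivity
  have hgi : Integrable (fun ω => f (w ω / √δ)) P := by
    have h1 : Integrable (fun x => f (x / √δ)) (P.map w) := by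
      rw [hw, aux_gauss_scale δ hδ.le, integrable_map_measure hfd.aestronglyMeasurable (by fun_prop)]
      refine hfi.congr (Filter.Eventually.of_forall fun x => ?_)
      simp only [Function.comp]
      congr 1
      field_simp
    exact (integrable_map_measure hfd.aestronglyMeasurable hwm.aemeasurable).1 h1
  have hge : ∫ ω, f (w ω / √δ) ∂P = ∫ x, f x ∂(gaussianReal 0 1) := by
    rw [← integral_map (f := fun x => f (x / √δ)) hwm.aemeasurable hfd.aestronglyMeasurable, hw,
      aux_gauss_scale δ hδ.le, integral_map (by fun_prop) hfd.aestronglyMeasurable]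
    congr 1
    ext x
    congr 1
    field_simp
  have i1 : Integrable (fun ω => S + y / S * (b * w ω)) P :=
    (integrable_const _).add ((hwi.const_mul b).const_mul _)
  have h1 : ∫ ω, ((S + y / S * (b * w ω)) + A * f (w ω / √δ)) ∂P
      = S + (∫ x, f x ∂(gaussianReal 0 1)) * A := by
    rw [integral_add i1 (hgi.const_mul A), integral_add (integrable_const _)
      ((hwi.const_mul b).const_mul _), integral_const_mul, integral_const_mul, hw0,
      integral_const_mul, hge]
    simp [mul_comm]
  calc _ = _ := h1.symm
    _ ≤ _ := by
      apply integral_mono (i1.add (hgi.const_mul A)) (aux_int_sqrt P w hwm hwi δ y b hδ.le)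
      intro ω
      simp only
      refine le_trans ?_ (aux_sqrt_lower δ y (b * w ω) hδ)
      rw [← hS]
      apply add_le_add_right
      set x := w ω / √δ with hx
      have hwx : w ω = √δ * x := by rw [hx]; field_simp
      set t := |b * w ω| with ht
      have ht2 : (b * w ω) ^ 2 = t ^ 2 := (sq_abs _).symm
      rw [ht2]
      set u := c * (√δ * |x|) with hu
      have hu0 : 0 ≤ u := by positivity
      have hut : u ≤ t := by
        rw [hu, ht, hwx, abs_mul, abs_mul, abs_of_pos hsδ0]
        exact mul_le_mul_of_nonneg_right hb (by positivity)
      have ht0 : 0 ≤ t := abs_nonneg _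
      have hstep1 : u ^ 2 * δ / (2 * (δ + y ^ 2) * (S + u)) ≤ t ^ 2 * δ / (2 * (δ + y ^ 2) * (S + t)) := by
        rw [div_le_div_iff₀ (by positivity) (by positivity)]
        have : u ^ 2 * (S + t) ≤ t ^ 2 * (S + u) := by
          have e : t ^ 2 * (S + u) - u ^ 2 * (S + t) = (t - u) * ((t + u) * S + t * u) := by ring
          have : 0 ≤ (t - u) * ((t + u) * S + t * u) := by
            apply mul_nonneg (by linarith); positivity
          linarith
        have := mul_le_mul_of_nonneg_left this (show 0 ≤ 2 * δ * (δ + y ^ 2) by positivity)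
        linarith
      refine le_trans ?_ hstep1
      have hu2 : u ^ 2 = c ^ 2 * δ * x ^ 2 := by
        rw [hu]; rw [mul_pow, mul_pow, hsδ, sq_abs]; ring
      have hSu : S + u ≤ S * (1 + c * |x|) := by
        have : √δ * (c * |x|) ≤ S * (c * |x|) := mul_le_mul_of_nonneg_right hSδ (by positivity)
        rw [hu]; linarith
      calc A * f x = u ^ 2 * δ / (2 * (δ + y ^ 2) * (S * (1 + c * |x|))) := by
            rw [hA, hu2]; simp only [hf]; field_simp
        _ ≤ _ := by
            apply div_le_div_of_nonneg_left (by positivity) (by positivity)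
            exact mul_le_mul_of_nonneg_left hSu (by positivity)

lemma aux_sqrt_lip (δ u v : ℝ) (hδ : 0 < δ) : √(δ + u ^ 2) ≤ √(δ + v ^ 2) + |v - u| := by
  apply Real.sqrt_le_iff.2
  refine ⟨by positivity, ?_⟩
  have h1 : |v| ≤ √(δ + v ^ 2) := by apply Real.abs_le_sqrt; linarith
  have h2 := Real.sq_sqrt (show 0 ≤ δ + v ^ 2 by positivity)
  have h3 : -(v * (v - u)) ≤ √(δ + v ^ 2) * |v - u| := by
    calc -(v * (v - u)) ≤ |v * (v - u)| := neg_le_abs _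
      _ = |v| * |v - u| := abs_mul _ _
      _ ≤ _ := mul_le_mul_of_nonneg_right h1 (abs_nonneg _)
  nlinarith [sq_abs (v - u)]

lemma aux_stepG (L Λ ε c : ℝ) (hL : 0 ≤ L) (hΛ : 0 ≤ Λ) (hε : 0 < ε) (hc : 0 < c) :
    ∃ κ C : ℝ, 0 < κ ∧ 0 < C ∧ ∀ {Ω : Type*} {_ : MeasurableSpace Ω}
    (P : Measure Ω) [IsProbabilityMeasure P]
    (w N : Ω → ℝ) (_ : Measurable w) (_ : Measurable N) (δ : ℝ) (_ : 0 < δ) (_ : δ ≤ 1)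
    (_ : P.map w = gaussianReal 0 (Real.toNNReal δ))
    (_ : Integrable (fun ω => N ω ^ 2) P) (_ : ∫ ω, N ω ^ 2 ∂P ≤ Λ * δ)
    (_ : ∀ᵐ ω ∂P, N ω = 0 ∨ 1 ≤ N ω)
    (y a b d : ℝ) (_ : |a| ≤ L * (1 + |y|)) (_ : |d| ≤ L * (1 + |y|)) (_ : |y| ≤ ε → c ≤ |b|),
    ENNReal.ofReal (√(δ + y ^ 2)) + ENNReal.ofReal (κ * (δ ^ 2 / ((δ + y ^ 2) * √(δ + y ^ 2))))
      ≤ ∫⁻ ω, ENNReal.ofReal (√(δ + (y + a * δ + b * w ω + d * N ω) ^ 2)) ∂P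
        + ENNReal.ofReal (C * δ * (1 + y ^ 2)) := by
  obtain ⟨κ, hκ, hstep⟩ := aux_stepW c hc
  refine ⟨κ, κ / ε ^ 3 + 2 * L * (1 + Λ) + 1, hκ, by positivity, ?_⟩
  intro Ω m0 P _ w N hwm hNm δ hδ hδ1 hw hNi hN2 hN01 y a b d ha hd hb
  obtain ⟨hwi, hw0, -, -⟩ := aux_gauss P w hwm δ hδ.le hw
  have hD : 0 < δ + y ^ 2 := by positivity
  have hS0 : 0 < √(δ + y ^ 2) := Real.sqrt_pos.2 hD
  have hA0 : 0 ≤ κ * (δ ^ 2 / ((δ + y ^ 2) * √(δ + y ^ 2))) := by positivity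
  have hreal : √(δ + y ^ 2) + κ * (δ ^ 2 / ((δ + y ^ 2) * √(δ + y ^ 2)))
      ≤ ∫ ω, √(δ + (y + b * w ω) ^ 2) ∂P + κ / ε ^ 3 * δ := by
    by_cases hy : |y| ≤ ε
    · have := hstep P w hwm δ hδ hw y b (hb hy)
      have h2 : 0 ≤ κ / ε ^ 3 * δ := by positivity
      linarith
    · push Not at hy
      have h1 := aux_stepW_weak P w hwm hwi hw0 δ y b hδ
      have h2 : κ * (δ ^ 2 / ((δ + y ^ 2) * √(δ + y ^ 2))) ≤ κ / ε ^ 3 * δ := by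
        have hyS : ε ≤ √(δ + y ^ 2) := by
          refine hy.le.trans ?_
          apply Real.abs_le_sqrt; linarith
        have hyD : ε ^ 2 ≤ δ + y ^ 2 := by
          have := pow_le_pow_left₀ hε.le hy.le 2
          rw [sq_abs] at this
          linarith
        have hDS : ε ^ 3 ≤ (δ + y ^ 2) * √(δ + y ^ 2) := by
          calc ε ^ 3 = ε ^ 2 * ε := by ring
            _ ≤ _ := mul_le_mul hyD hyS hε.le hD.le
        calc κ * (δ ^ 2 / ((δ + y ^ 2) * √(δ + y ^ 2))) ≤ κ * (δ / ε ^ 3) := by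
              apply mul_le_mul_of_nonneg_left _ hκ.le
              apply div_le_div₀ hδ.le _ (by positivity) hDS
              nlinarith
          _ = _ := by ring
      linarith
  have hY : 1 + |y| ≤ 2 * (1 + y ^ 2) := by
    nlinarith [sq_abs y, sq_nonneg (|y| - 1)]
  have hri : Integrable (fun ω => |a| * δ + |d| * N ω ^ 2) P :=
    (integrable_const _).add (hNi.const_mul _)
  have hrI : ∫ ω, (|a| * δ + |d| * N ω ^ 2) ∂P ≤ 2 * L * (1 + Λ) * δ * (1 + y ^ 2) := by
    rw [integral_add (integrable_const _) (hNi.const_mul _), integral_const_mul |d|]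
    simp only [integral_const, probReal_univ, smul_eq_mul, one_mul]
    have h1 : |d| * ∫ ω, N ω ^ 2 ∂P ≤ (L * (1 + |y|)) * (Λ * δ) :=
      mul_le_mul hd hN2 (integral_nonneg fun ω => sq_nonneg _) (by positivity)
    have h2 : |a| * δ ≤ (L * (1 + |y|)) * δ := mul_le_mul_of_nonneg_right ha hδ.le
    have h3 := mul_le_mul_of_nonneg_left hY (show 0 ≤ L * (1 + Λ) * δ by positivity)
    linarith
  have hpt : ∀ᵐ ω ∂P, √(δ + (y + b * w ω) ^ 2)
      ≤ √(δ + (y + a * δ + b * w ω + d * N ω) ^ 2) + (|a| * δ + |d| * N ω ^ 2) := by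
    filter_upwards [hN01] with ω hω
    refine (aux_sqrt_lip δ _ (y + a * δ + b * w ω + d * N ω) hδ).trans ?_
    gcongr
    have e : y + a * δ + b * w ω + d * N ω - (y + b * w ω) = a * δ + d * N ω := by ring
    rw [e]
    refine (abs_add_le _ _).trans ?_
    rw [abs_mul, abs_mul, abs_of_pos hδ]
    gcongr
    rcases hω with h | h
    · rw [h]; simp
    · rw [abs_of_nonneg (by linarith)]; nlinarith
  have hlin : ENNReal.ofReal (∫ ω, √(δ + (y + b * w ω) ^ 2) ∂P)
      ≤ ∫⁻ ω, ENNReal.ofReal (√(δ + (y + a * δ + b * w ω + d * N ω) ^ 2)) ∂P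
        + ENNReal.ofReal (2 * L * (1 + Λ) * δ * (1 + y ^ 2)) := by
    rw [ofReal_integral_eq_lintegral_ofReal (aux_int_sqrt P w hwm hwi δ y b hδ.le)
      (Filter.Eventually.of_forall fun ω => Real.sqrt_nonneg _)]
    calc ∫⁻ ω, ENNReal.ofReal (√(δ + (y + b * w ω) ^ 2)) ∂P
        ≤ ∫⁻ ω, (ENNReal.ofReal (√(δ + (y + a * δ + b * w ω + d * N ω) ^ 2))
            + ENNReal.ofReal (|a| * δ + |d| * N ω ^ 2)) ∂P := by
          apply lintegral_mono_ae
          filter_upwards [hpt] with ω hω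
          rw [← ENNReal.ofReal_add (Real.sqrt_nonneg _) (by positivity)]
          exact ENNReal.ofReal_le_ofReal hω
      _ = ∫⁻ ω, ENNReal.ofReal (√(δ + (y + a * δ + b * w ω + d * N ω) ^ 2)) ∂P
          + ∫⁻ ω, ENNReal.ofReal (|a| * δ + |d| * N ω ^ 2) ∂P :=
          lintegral_add_left (by fun_prop) _
      _ ≤ _ := by
          gcongr
          rw [← ofReal_integral_eq_lintegral_ofReal hri
            (Filter.Eventually.of_forall fun ω => by positivity)]
          exact ENNReal.ofReal_le_ofReal hrI
  calc ENNReal.ofReal (√(δ + y ^ 2)) + ENNReal.ofReal (κ * (δ ^ 2 / ((δ + y ^ 2) * √(δ + y ^ 2))))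
      = ENNReal.ofReal (√(δ + y ^ 2) + κ * (δ ^ 2 / ((δ + y ^ 2) * √(δ + y ^ 2)))) :=
        (ENNReal.ofReal_add (Real.sqrt_nonneg _) hA0).symm
    _ ≤ ENNReal.ofReal (∫ ω, √(δ + (y + b * w ω) ^ 2) ∂P + κ / ε ^ 3 * δ) :=
        ENNReal.ofReal_le_ofReal hreal
    _ ≤ ENNReal.ofReal (∫ ω, √(δ + (y + b * w ω) ^ 2) ∂P) + ENNReal.ofReal (κ / ε ^ 3 * δ) :=
        ENNReal.ofReal_add_le
    _ ≤ (∫⁻ ω, ENNReal.ofReal (√(δ + (y + a * δ + b * w ω + d * N ω) ^ 2)) ∂P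
        + ENNReal.ofReal (2 * L * (1 + Λ) * δ * (1 + y ^ 2))) + ENNReal.ofReal (κ / ε ^ 3 * δ) := by
        gcongr
    _ ≤ _ := by
        rw [add_assoc, ← ENNReal.ofReal_add (by positivity) (by positivity)]
        gcongr
        have h1 : 0 ≤ κ / ε ^ 3 * δ * y ^ 2 := by positivity
        have h2 : 0 ≤ δ * (1 + y ^ 2) := by positivity
        nlinarith

lemma aux_stepL2 (L Λ : ℝ) (hL : 0 ≤ L) (hΛ : 0 ≤ Λ) :
    ∃ C : ℝ, 0 < C ∧ ∀ {Ω : Type*} {_ : MeasurableSpace Ω}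
    (P : Measure Ω) [IsProbabilityMeasure P]
    (w N : Ω → ℝ) (_ : Measurable w) (_ : Measurable N) (δ : ℝ) (_ : 0 < δ) (_ : δ ≤ 1)
    (_ : P.map w = gaussianReal 0 (Real.toNNReal δ))
    (_ : Integrable (fun ω => N ω ^ 2) P) (_ : ∫ ω, N ω ^ 2 ∂P ≤ Λ * δ)
    (_ : ∀ᵐ ω ∂P, N ω = 0 ∨ 1 ≤ N ω)
    (y a b d : ℝ) (_ : |a| ≤ L * (1 + |y|)) (_ : |b| ≤ L * (1 + |y|)) (_ : |d| ≤ L * (1 + |y|)),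
    ∫⁻ ω, ENNReal.ofReal (1 + (y + a * δ + b * w ω + d * N ω) ^ 2) ∂P
      ≤ ENNReal.ofReal ((1 + C * δ) * (1 + y ^ 2)) := by
  refine ⟨4 * L + 4 * L * Λ + 6 * L ^ 2 * (2 + Λ) + 1, by positivity, ?_⟩
  intro Ω m0 P _ w N hwm hNm δ hδ hδ1 hw hNi hN2 hN01 y a b d ha hb hd
  obtain ⟨hwi, hw0, hw2i, hw2⟩ := aux_gauss P w hwm δ hδ.le hw
  set A0 : ℝ := 1 + y ^ 2 + 2 * |y| * |a| * δ + 3 * a ^ 2 * δ ^ 2 with hA0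
  set A3 : ℝ := 2 * |y| * |d| + 3 * d ^ 2 with hA3
  have hA30 : 0 ≤ A3 := by positivity
  set g : Ω → ℝ := fun ω => A0 + 2 * y * b * w ω + 3 * b ^ 2 * w ω ^ 2 + A3 * N ω ^ 2 with hg
  have i1 : Integrable (fun ω => A0 + 2 * y * b * w ω) P :=
    (integrable_const _).add (hwi.const_mul _)
  have i2 : Integrable (fun ω => A0 + 2 * y * b * w ω + 3 * b ^ 2 * w ω ^ 2) P :=
    i1.add (hw2i.const_mul _)
  have hgi : Integrable g P := i2.add (hNi.const_mul _)
  have hgI : ∫ ω, g ω ∂P = A0 + 3 * b ^ 2 * δ + A3 * ∫ ω, N ω ^ 2 ∂P := by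
    simp only [hg]
    rw [integral_add i2 (hNi.const_mul _), integral_add i1 (hw2i.const_mul _),
      integral_add (integrable_const _) (hwi.const_mul _), integral_const_mul, integral_const_mul,
      integral_const_mul, hw0, hw2]
    simp
  have hpt : ∀ᵐ ω ∂P, 1 + (y + a * δ + b * w ω + d * N ω) ^ 2 ≤ g ω := by
    filter_upwards [hN01] with ω hω
    have hN : |N ω| ≤ N ω ^ 2 := by
      rcases hω with h | h
      · rw [h]; simp
      · rw [abs_of_nonneg (by linarith)]; nlinarith
    have h1 : y * (a * δ) ≤ |y| * |a| * δ := by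
      calc y * (a * δ) ≤ |y * (a * δ)| := le_abs_self _
        _ = |y| * |a| * δ := by rw [abs_mul, abs_mul, abs_of_pos hδ]; ring
    have h2 : y * (d * N ω) ≤ |y| * |d| * N ω ^ 2 := by
      calc y * (d * N ω) ≤ |y * (d * N ω)| := le_abs_self _
        _ = |y| * |d| * |N ω| := by rw [abs_mul, abs_mul]; ring
        _ ≤ _ := mul_le_mul_of_nonneg_left hN (by positivity)
    simp only [hg, hA0, hA3]
    nlinarith [sq_nonneg (a * δ - b * w ω), sq_nonneg (a * δ - d * N ω),
      sq_nonneg (b * w ω - d * N ω)]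
  have hle : ∫⁻ ω, ENNReal.ofReal (1 + (y + a * δ + b * w ω + d * N ω) ^ 2) ∂P
      ≤ ENNReal.ofReal (∫ ω, g ω ∂P) := by
    rw [ofReal_integral_eq_lintegral_ofReal hgi]
    · apply lintegral_mono_ae
      filter_upwards [hpt] with ω hω
      exact ENNReal.ofReal_le_ofReal hω
    · filter_upwards [hpt] with ω hω
      refine le_trans ?_ hω
      positivity
  refine hle.trans (ENNReal.ofReal_le_ofReal ?_)
  rw [hgI]
  have hN2' : A3 * ∫ ω, N ω ^ 2 ∂P ≤ A3 * (Λ * δ) := mul_le_mul_of_nonneg_left hN2 hA30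
  have hsq : (1 + |y|) ^ 2 ≤ 2 * (1 + y ^ 2) := by nlinarith [sq_abs y, sq_nonneg (|y| - 1)]
  have hyy : |y| * (1 + |y|) ≤ 2 * (1 + y ^ 2) := by nlinarith [sq_abs y, sq_nonneg (|y| - 1), abs_nonneg y]
  have hq : ∀ z : ℝ, |z| ≤ L * (1 + |y|) → z ^ 2 ≤ 2 * L ^ 2 * (1 + y ^ 2) := by
    intro z hz
    have := pow_le_pow_left₀ (abs_nonneg z) hz 2
    rw [sq_abs, mul_pow] at this
    nlinarith [mul_le_mul_of_nonneg_left hsq (sq_nonneg L)]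
  have hp : ∀ z : ℝ, |z| ≤ L * (1 + |y|) → |y| * |z| ≤ 2 * L * (1 + y ^ 2) := by
    intro z hz
    have := mul_le_mul_of_nonneg_left hz (abs_nonneg y)
    nlinarith [mul_le_mul_of_nonneg_left hyy hL]
  have ha2 := hq a ha
  have hb2 := hq b hb
  have hd2 := hq d hd
  have hya := hp a ha
  have hyd := hp d hd
  have hδ2 : δ ^ 2 ≤ δ := by nlinarith
  have e1 : a ^ 2 * δ ^ 2 ≤ 2 * L ^ 2 * (1 + y ^ 2) * δ :=
    mul_le_mul ha2 hδ2 (by positivity) (by positivity)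
  have e2 : b ^ 2 * δ ≤ 2 * L ^ 2 * (1 + y ^ 2) * δ := mul_le_mul_of_nonneg_right hb2 hδ.le
  have e3 : |y| * |a| * δ ≤ 2 * L * (1 + y ^ 2) * δ := mul_le_mul_of_nonneg_right hya hδ.le
  have e4 : A3 * (Λ * δ) ≤ (2 * (2 * L * (1 + y ^ 2)) + 3 * (2 * L ^ 2 * (1 + y ^ 2))) * (Λ * δ) := by
    apply mul_le_mul_of_nonneg_right _ (by positivity)
    rw [hA3]; linarith
  have e5 : 0 ≤ δ * (1 + y ^ 2) := by positivity
  rw [hA0]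
  nlinarith

set_option maxHeartbeats 1000000 in
lemma aux_cross (L Λ : ℝ) (hL : 0 ≤ L) (hΛ : 0 ≤ Λ) :
    ∃ K : ℝ, 0 < K ∧ ∀ {Ω : Type*} {_ : MeasurableSpace Ω}
    (P : Measure Ω) [IsProbabilityMeasure P]
    (w N : Ω → ℝ) (_ : Measurable w) (_ : Measurable N) (h δ : ℝ) (_ : 0 ≤ h) (_ : h ≤ δ)
    (_ : 0 < δ) (_ : δ ≤ 1)
    (_ : P.map w = gaussianReal 0 (Real.toNNReal h))
    (_ : Integrable (fun ω => N ω ^ 2) P) (_ : ∫ ω, N ω ^ 2 ∂P ≤ Λ * δ)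
    (_ : ∀ᵐ ω ∂P, N ω = 0 ∨ 1 ≤ N ω)
    (y a b d : ℝ) (_ : |a| ≤ L * (1 + |y|)) (_ : |b| ≤ L * (1 + |y|)),
    P {ω | y * (y + a * h + b * w ω + d * N ω) ≤ 0}
      ≤ ENNReal.ofReal (K * (δ * √δ / ((δ + y ^ 2) * √(δ + y ^ 2)) + δ)) := by
  obtain ⟨M, hM, hcube⟩ := aux_gauss_cube
  set B : ℝ := 1 + 2 * L with hB
  have hB1 : 1 ≤ B := by rw [hB]; linarith
  refine ⟨Λ + B ^ 3 * M, by positivity, ?_⟩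
  intro Ω m0 P _ w N hwm hNm h δ hh hhδ hδ hδ1 hw hNi hN2 hN01 y a b d ha hb
  obtain ⟨h3, h2⟩ := hcube P w hwm h δ hh hhδ hw
  have hD : 0 < δ + y ^ 2 := by positivity
  have hS0 : 0 < √(δ + y ^ 2) := Real.sqrt_pos.2 hD
  set Q : ℝ := (δ + y ^ 2) * √(δ + y ^ 2) with hQ
  have hQ0 : 0 < Q := by positivity
  have hsδ0 : 0 < √δ := Real.sqrt_pos.2 hδ
  have hsδ : √δ ^ 2 = δ := Real.sq_sqrt hδ.le
  have hδs : δ ≤ √δ := by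
    have : √δ ≤ 1 := Real.sqrt_le_one.2 hδ1
    nlinarith
  have hset : MeasurableSet {ω | y * (y + a * h + b * w ω + d * N ω) ≤ 0} :=
    measurableSet_le (by fun_prop) measurable_const
  have hpt : ∀ᵐ ω ∂P, Set.indicator {ω | y * (y + a * h + b * w ω + d * N ω) ≤ 0} (fun _ => (1:ENNReal)) ω
      ≤ ENNReal.ofReal (N ω ^ 2) + (ENNReal.ofReal (B ^ 3 / Q) * ENNReal.ofReal ((2 * √δ + |w ω|) ^ 3)
        + ENNReal.ofReal (B ^ 3) * ENNReal.ofReal ((2 * √δ + |w ω|) ^ 2)) := by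
    filter_upwards [hN01] with ω hω
    by_cases hmem : ω ∈ {ω | y * (y + a * h + b * w ω + d * N ω) ≤ 0}
    swap
    · rw [Set.indicator_of_notMem hmem]; exact zero_le
    rw [Set.indicator_of_mem hmem]
    rw [Set.mem_ofPred_eq] at hmem
    set q := 2 * √δ + |w ω| with hq
    have hq0 : 0 < q := by positivity
    rw [← ENNReal.ofReal_mul (by positivity), ← ENNReal.ofReal_mul (by positivity),
      ← ENNReal.ofReal_add (by positivity) (by positivity),
      ← ENNReal.ofReal_add (by positivity) (by positivity), ENNReal.one_le_ofReal]
    have t1 : 0 ≤ B ^ 3 / Q * q ^ 3 := by positivity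
    have t2 : 0 ≤ B ^ 3 * q ^ 2 := by positivity
    rcases hω with hN0 | hN1
    swap
    · have : 1 ≤ N ω ^ 2 := by nlinarith
      linarith
    rw [hN0] at hmem ⊢
    have hyle : |y| ≤ |a * h + b * w ω| := by
      by_contra hcon
      push Not at hcon
      have h1 : 0 < |y| := (abs_nonneg _).trans_lt hcon
      have h2 : -(y * (a * h + b * w ω)) ≤ |y| * |a * h + b * w ω| := by
        rw [← abs_mul]; exact neg_le_abs _
      have h4 : |y| * |a * h + b * w ω| < |y| * |y| := mul_lt_mul_of_pos_left hcon h1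
      rw [← sq, sq_abs] at h4
      nlinarith
    have hyq : |y| ≤ L * (1 + |y|) * q := by
      refine hyle.trans ((abs_add_le _ _).trans ?_)
      rw [abs_mul, abs_mul, abs_of_nonneg hh]
      have e1 : |a| * h ≤ L * (1 + |y|) * √δ := mul_le_mul ha (hhδ.trans hδs) hh (by positivity)
      have e2 : |b| * |w ω| ≤ L * (1 + |y|) * |w ω| := mul_le_mul_of_nonneg_right hb (abs_nonneg _)
      have e3 : 0 ≤ L * (1 + |y|) * √δ := by positivity
      rw [hq]
      linarith
    have hδq : δ ≤ q ^ 2 := by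
      rw [← hsδ]
      apply pow_le_pow_left₀ hsδ0.le
      rw [hq]; linarith [abs_nonneg (w ω)]
    by_cases hy1 : |y| ≤ 1
    · have hy2 : |y| ≤ 2 * L * q := by
        have : L * (1 + |y|) * q ≤ L * (1 + 1) * q := by gcongr
        linarith
      have hDle : δ + y ^ 2 ≤ (B * q) ^ 2 := by
        have := pow_le_pow_left₀ (abs_nonneg y) hy2 2
        rw [sq_abs] at this
        rw [hB]
        nlinarith [mul_nonneg hL (sq_nonneg q)]
      have hSle : √(δ + y ^ 2) ≤ B * q := Real.sqrt_le_iff.2 ⟨by positivity, hDle⟩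
      have hQle : Q ≤ B ^ 3 * q ^ 3 := by
        calc Q ≤ (B * q) ^ 2 * (B * q) := mul_le_mul hDle hSle hS0.le (by positivity)
          _ = _ := by ring
      have : 1 ≤ B ^ 3 / Q * q ^ 3 := by
        rw [div_mul_eq_mul_div, one_le_div hQ0]; exact hQle
      have t3 : (0:ℝ) ≤ 0 ^ 2 := by norm_num
      linarith
    · push Not at hy1
      have h1 : |y| ≤ L * (2 * |y|) * q := by
        refine hyq.trans ?_
        gcongr
        linarith
      have h1' : 1 ≤ B * q := by
        by_contra hcon
        push Not at hcon
        have : 2 * L * q < 1 := by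
          rw [hB] at hcon; nlinarith
        nlinarith
      have h2 : 1 ≤ B ^ 3 * q ^ 2 := by
        have e1 : 1 ≤ (B * q) ^ 2 := one_le_pow₀ h1'
        have e2 : (B * q) ^ 2 ≤ B * (B * q) ^ 2 := le_mul_of_one_le_left (by positivity) hB1
        calc 1 ≤ B * (B * q) ^ 2 := e1.trans e2
          _ = _ := by ring
      have t3 : (0:ℝ) ≤ 0 ^ 2 := by norm_num
      linarith
  calc P {ω | y * (y + a * h + b * w ω + d * N ω) ≤ 0}
      = ∫⁻ ω, Set.indicator {ω | y * (y + a * h + b * w ω + d * N ω) ≤ 0} (fun _ => (1:ENNReal)) ω ∂P := by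
        rw [lintegral_indicator hset]; simp
    _ ≤ _ := lintegral_mono_ae hpt
    _ = ∫⁻ ω, ENNReal.ofReal (N ω ^ 2) ∂P
        + (ENNReal.ofReal (B ^ 3 / Q) * ∫⁻ ω, ENNReal.ofReal ((2 * √δ + |w ω|) ^ 3) ∂P
        + ENNReal.ofReal (B ^ 3) * ∫⁻ ω, ENNReal.ofReal ((2 * √δ + |w ω|) ^ 2) ∂P) := by
        rw [lintegral_add_left (by fun_prop), lintegral_add_left (by fun_prop),
          lintegral_const_mul _ (by fun_prop), lintegral_const_mul _ (by fun_prop)]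
    _ ≤ ENNReal.ofReal (Λ * δ) + (ENNReal.ofReal (B ^ 3 / Q) * ENNReal.ofReal (M * (δ * √δ))
        + ENNReal.ofReal (B ^ 3) * ENNReal.ofReal (M * δ)) := by
        gcongr
        rw [← ofReal_integral_eq_lintegral_ofReal hNi
          (Filter.Eventually.of_forall fun ω => by positivity)]
        exact ENNReal.ofReal_le_ofReal hN2
    _ ≤ _ := by
        rw [← ENNReal.ofReal_mul (by positivity), ← ENNReal.ofReal_mul (by positivity),
          ← ENNReal.ofReal_add (by positivity) (by positivity),
          ← ENNReal.ofReal_add (by positivity) (by positivity)]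
        apply ENNReal.ofReal_le_ofReal
        have e : B ^ 3 / Q * (M * (δ * √δ)) = B ^ 3 * M * (δ * √δ / Q) := by ring
        rw [e]
        have : 0 ≤ Λ * (δ * √δ / Q) := by positivity
        linarith

lemma aux_telescope (a b p : ℕ → ENNReal) (κ C C' δ T : ℝ) (hC : 0 ≤ C) (hC' : 0 ≤ C')
    (hδ : 0 ≤ δ) (d : ℕ) (hd : (d:ℝ) * δ ≤ T)
    (h1 : ∀ i < d, a i + ENNReal.ofReal κ * p i ≤ a (i + 1) + ENNReal.ofReal (C * δ) * b i)
    (h2 : ∀ i < d, b (i + 1) ≤ ENNReal.ofReal (1 + C' * δ) * b i)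
    (h3 : ∀ i ≤ d, a i ≤ b i) :
    ENNReal.ofReal κ * ∑ i ∈ Finset.range d, p i
      ≤ ENNReal.ofReal ((1 + C * T) * Real.exp (C' * T)) * b 0 := by
  have hT : 0 ≤ T := le_trans (by positivity) hd
  have hb : ∀ i ≤ d, b i ≤ ENNReal.ofReal (Real.exp (C' * δ * i)) * b 0 := by
    intro i
    induction i with
    | zero => intro _; simp
    | succ i ih =>
      intro hi
      calc b (i + 1) ≤ ENNReal.ofReal (1 + C' * δ) * b i := h2 i (by omega)
        _ ≤ ENNReal.ofReal (Real.exp (C' * δ)) * (ENNReal.ofReal (Real.exp (C' * δ * i)) * b 0) := by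
          gcongr
          · have := Real.add_one_le_exp (C' * δ); linarith
          · exact ih (by omega)
        _ = _ := by
          rw [← mul_assoc, ← ENNReal.ofReal_mul (Real.exp_nonneg _), ← Real.exp_add]
          congr 3
          push_cast; ring
  have hbT : ∀ i ≤ d, b i ≤ ENNReal.ofReal (Real.exp (C' * T)) * b 0 := by
    intro i hi
    refine (hb i hi).trans ?_
    refine mul_le_mul' (ENNReal.ofReal_le_ofReal (Real.exp_le_exp.2 ?_)) le_rfl
    rw [mul_assoc]
    refine mul_le_mul_of_nonneg_left ?_ hC'
    have : (i:ℝ) ≤ d := by exact_mod_cast hi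
    nlinarith
  have ht : ∀ l ≤ d, a 0 + ENNReal.ofReal κ * ∑ i ∈ Finset.range l, p i
      ≤ a l + ENNReal.ofReal (C * δ) * ∑ i ∈ Finset.range l, b i := by
    intro l
    induction l with
    | zero => intro _; simp
    | succ l ih =>
      intro hl
      rw [Finset.sum_range_succ, Finset.sum_range_succ, mul_add, mul_add]
      calc a 0 + (ENNReal.ofReal κ * ∑ i ∈ Finset.range l, p i + ENNReal.ofReal κ * p l)
          = (a 0 + ENNReal.ofReal κ * ∑ i ∈ Finset.range l, p i) + ENNReal.ofReal κ * p l := by ring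
        _ ≤ (a l + ENNReal.ofReal (C * δ) * ∑ i ∈ Finset.range l, b i) + ENNReal.ofReal κ * p l := by
          exact add_le_add (ih (by omega)) le_rfl
        _ = (a l + ENNReal.ofReal κ * p l) + ENNReal.ofReal (C * δ) * ∑ i ∈ Finset.range l, b i := by
          ring
        _ ≤ (a (l + 1) + ENNReal.ofReal (C * δ) * b l)
            + ENNReal.ofReal (C * δ) * ∑ i ∈ Finset.range l, b i := by
          exact add_le_add (h1 l (by omega)) le_rfl
        _ = _ := by ring
  calc ENNReal.ofReal κ * ∑ i ∈ Finset.range d, p i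
      ≤ a 0 + ENNReal.ofReal κ * ∑ i ∈ Finset.range d, p i := le_add_self
    _ ≤ a d + ENNReal.ofReal (C * δ) * ∑ i ∈ Finset.range d, b i := ht d le_rfl
    _ ≤ ENNReal.ofReal (Real.exp (C' * T)) * b 0
        + ENNReal.ofReal (C * δ) * ∑ i ∈ Finset.range d, ENNReal.ofReal (Real.exp (C' * T)) * b 0 := by
        gcongr with i hi
        · exact (h3 d le_rfl).trans (hbT d le_rfl)
        · exact hbT i (Finset.mem_range.1 hi).le
    _ = ENNReal.ofReal ((1 + C * (d * δ)) * Real.exp (C' * T)) * b 0 := by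
        rw [Finset.sum_const, Finset.card_range, nsmul_eq_mul, ← mul_assoc, ← mul_assoc,
          ← ENNReal.ofReal_natCast d, ← ENNReal.ofReal_mul (by positivity),
          ← ENNReal.ofReal_mul (by positivity), ← add_mul,
          ← ENNReal.ofReal_add (by positivity) (by positivity)]
        congr 2
        ring
    _ ≤ _ := by gcongr

lemma aux_meas_step {Ω : Type*} {m : MeasurableSpace Ω} (μ σ ρ : ℝ → ℝ) (hμ : Measurable μ)
    (hσ : Measurable σ) (hρ : Measurable ρ) (X W1 W2 N1 N2 : Ω → ℝ) (hX : Measurable X)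
    (hW1 : Measurable W1) (hW2 : Measurable W2) (hN1 : Measurable N1) (hN2 : Measurable N2) (h : ℝ) :
    Measurable (fun ω => X ω + μ (X ω) * h + σ (X ω) * (W1 ω - W2 ω) + ρ (X ω) * (N1 ω - N2 ω)) := by
  fun_prop

lemma aux_meas_set {Ω : Type*} {m : MeasurableSpace Ω} (X Y : Ω → ℝ) (hX : Measurable X)
    (hY : Measurable Y) (z : ℝ) : MeasurableSet {ω | (X ω - z) * (Y ω - z) ≤ 0} :=
  measurableSet_le (by fun_prop) measurable_const

lemma aux_floor (δ t : ℝ) (hδ : 0 < δ) (j : ℕ) (h1 : (j:ℝ) * δ ≤ t) (h2 : t < ((j:ℝ) + 1) * δ) :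
    ⌊t / δ⌋.toNat = j := by
  have : ⌊t / δ⌋ = (j : ℤ) := by
    rw [Int.floor_eq_iff]
    constructor
    · rw [le_div_iff₀ hδ]; exact_mod_cast h1
    · rw [div_lt_iff₀ hδ]; exact_mod_cast h2
  rw [this]; simp

lemma aux_emProc_grid {Ω : Type*} (μ σ ρ : ℝ → ℝ) (W N : ℝ → Ω → ℝ) (δ x : ℝ) (hδ : 0 < δ) (j : ℕ)
    (ω : Ω) : emProc μ σ ρ W N δ x ((j:ℝ) * δ) ω = emGrid μ σ ρ W N δ x j ω := by
  have h := aux_floor δ ((j:ℝ) * δ) hδ j le_rfl (by linarith)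
  simp [emProc, lastGrid, h]

lemma aux_cross_eq {Ω : Type*} (μ σ ρ : ℝ → ℝ) (W N : ℝ → Ω → ℝ) (δ x z t : ℝ) (hδ : 0 < δ) (j : ℕ)
    (h1 : (j:ℝ) * δ ≤ t) (h2 : t < ((j:ℝ) + 1) * δ) :
    crossEvent μ σ ρ W N δ x z t = {ω | (emGrid μ σ ρ W N δ x j ω - z) *
      ((emGrid μ σ ρ W N δ x j ω + μ (emGrid μ σ ρ W N δ x j ω) * (t - (j:ℝ) * δ)
        + σ (emGrid μ σ ρ W N δ x j ω) * (W t ω - W ((j:ℝ) * δ) ω)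
        + ρ (emGrid μ σ ρ W N δ x j ω) * (N t ω - N ((j:ℝ) * δ) ω)) - z) ≤ 0} := by
  have h := aux_floor δ t hδ j h1 h2
  have hl : lastGrid δ t = (j:ℝ) * δ := by simp [lastGrid, h]
  unfold crossEvent
  rw [hl]
  ext ω
  simp only [Set.mem_ofPred_eq]
  rw [aux_emProc_grid μ σ ρ W N δ x hδ j ω]
  simp only [emProc, h, hl]

lemma aux_emGrid_meas {Ω : Type*} {m0 : MeasurableSpace Ω} (F : Filtration ℝ m0) (T : ℝ)
    (W N : ℝ → Ω → ℝ)
    (hW : ∀ t ∈ Set.Icc (0:ℝ) T, Measurable[F t] (W t))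
    (hN : ∀ t ∈ Set.Icc (0:ℝ) T, Measurable[F t] (N t))
    (μ σ ρ : ℝ → ℝ) (hμ : Measurable μ) (hσ : Measurable σ) (hρ : Measurable ρ)
    (δ x : ℝ) (hδ : 0 < δ) (j : ℕ) (hj : (j:ℝ) * δ ≤ T) :
    Measurable[F ((j:ℝ) * δ)] (emGrid μ σ ρ W N δ x j) := by
  induction j with
  | zero =>
    have : emGrid μ σ ρ W N δ x 0 = fun _ => x := by funext ω; rfl
    rw [this]; exact measurable_const
  | succ j ih =>
    have hc : ((j + 1 : ℕ) : ℝ) * δ = ((j:ℝ) + 1) * δ := by push_cast; ring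
    rw [hc] at hj ⊢
    have hle : (j:ℝ) * δ ≤ ((j:ℝ) + 1) * δ := by linarith
    have h0 : 0 ≤ (j:ℝ) * δ := by positivity
    have hF := F.mono hle
    have e : emGrid μ σ ρ W N δ x (j + 1) = fun ω =>
        emGrid μ σ ρ W N δ x j ω + μ (emGrid μ σ ρ W N δ x j ω) * δ
        + σ (emGrid μ σ ρ W N δ x j ω) * (W (((j : ℝ) + 1) * δ) ω - W ((j : ℝ) * δ) ω)
        + ρ (emGrid μ σ ρ W N δ x j ω) * (N (((j : ℝ) + 1) * δ) ω - N ((j : ℝ) * δ) ω) := by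
      funext ω; rfl
    rw [e]
    exact aux_meas_step (m := F (((j : ℝ) + 1) * δ)) μ σ ρ hμ hσ hρ _ _ _ _ _
      ((ih (hle.trans hj)).mono hF le_rfl) (hW _ ⟨h0.trans hle, hj⟩)
      ((hW _ ⟨h0, hle.trans hj⟩).mono hF le_rfl) (hN _ ⟨h0.trans hle, hj⟩)
      ((hN _ ⟨h0, hle.trans hj⟩).mono hF le_rfl) δ

/-- Moment facts on the Poisson increments. -/
lemma aux_N_facts {Ω : Type*} {m0 : MeasurableSpace Ω} (P : Measure Ω)
    (T : ℝ) (lam : ℝ → ℝ)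
    (hlam_pos : ∀ t ∈ Set.Icc (0:ℝ) T, 0 < lam t)
    (lamB : ℝ) (hlamB : ∀ t ∈ Set.Icc (0:ℝ) T, lam t ≤ lamB)
    (Nn : Ω → ℝ) (hNm : Measurable Nn) (s t δ : ℝ) (hs : 0 ≤ s) (hst : s ≤ t) (htT : t ≤ T)
    (hδ : t - s ≤ δ) (hδ1 : δ ≤ 1)
    (hN : Measure.map Nn P = Measure.map (fun k : ℕ => (k : ℝ))
            (poissonMeasure (Real.toNNReal (∫ u in s..t, lam u)))) :
    Integrable (fun ω => Nn ω ^ 2) P ∧ ∫ ω, Nn ω ^ 2 ∂P ≤ (|lamB| + |lamB| ^ 2) * δ ∧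
      ∀ᵐ ω ∂P, Nn ω = 0 ∨ 1 ≤ Nn ω := by
  obtain ⟨h1, h2, h3⟩ := aux_poisson P Nn hNm _ hN
  refine ⟨h1, ?_, h3⟩
  rw [h2]
  have hI : ‖∫ u in s..t, lam u‖ ≤ |lamB| * |t - s| := by
    apply intervalIntegral.norm_integral_le_of_norm_le_const
    intro u hu
    rw [Set.uIoc_of_le hst] at hu
    have hmem : u ∈ Set.Icc (0:ℝ) T := ⟨hs.trans hu.1.le, hu.2.trans htT⟩
    rw [Real.norm_of_nonneg (hlam_pos u hmem).le]
    exact (hlamB u hmem).trans (le_abs_self _)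
  rw [abs_of_nonneg (by linarith : 0 ≤ t - s)] at hI
  have hδ0 : 0 ≤ δ := by linarith
  set r : ℝ := ((Real.toNNReal (∫ u in s..t, lam u) : NNReal) : ℝ) with hr
  have hr0 : 0 ≤ r := NNReal.coe_nonneg _
  have hrle : r ≤ |lamB| * δ := by
    rw [hr, Real.coe_toNNReal']
    apply max_le _ (by positivity)
    refine (le_abs_self _).trans (hI.trans ?_)
    gcongr
  have hr2 : r ^ 2 ≤ |lamB| ^ 2 * δ := by
    calc r ^ 2 ≤ (|lamB| * δ) ^ 2 := pow_le_pow_left₀ hr0 hrle 2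
      _ = |lamB| ^ 2 * δ ^ 2 := by ring
      _ ≤ _ := by
        gcongr
        nlinarith
  linarith

lemma aux_time (g : ℝ → ENNReal) (δ s T : ℝ) (hδ : 0 < δ) (j0 d : ℕ) (hT : T = ((j0:ℝ) + d) * δ)
    (hs : s ≤ (j0:ℝ) * δ) (hs2 : (j0:ℝ) * δ - s ≤ δ) (pA : ENNReal) (c : ℕ → ENNReal)
    (h1 : ∀ t, g t ≤ pA)
    (h2 : ∀ i < d, ∀ t, ((j0:ℝ) + i) * δ ≤ t → t < ((j0:ℝ) + i + 1) * δ → g t ≤ c i) :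
    ∫⁻ t in Set.Icc s T, g t ≤ ENNReal.ofReal δ * pA
      + ∑ i ∈ Finset.range d, ENNReal.ofReal δ * c i := by
  have key : ∀ l ≤ d, ∫⁻ t in Set.Ico s (((j0:ℝ) + l) * δ), g t ≤ ENNReal.ofReal δ * pA
      + ∑ i ∈ Finset.range l, ENNReal.ofReal δ * c i := by
    intro l
    induction l with
    | zero =>
      intro _
      simp only [Nat.cast_zero, add_zero, Finset.range_zero, Finset.sum_empty]
      calc ∫⁻ t in Set.Ico s ((j0:ℝ) * δ), g t ≤ ∫⁻ t in Set.Ico s ((j0:ℝ) * δ), pA :=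
            lintegral_mono (fun t => h1 t)
        _ = pA * ENNReal.ofReal ((j0:ℝ) * δ - s) := by
            rw [setLIntegral_const, Real.volume_Ico]
        _ ≤ ENNReal.ofReal δ * pA := by
            rw [mul_comm]
            exact mul_le_mul' (ENNReal.ofReal_le_ofReal hs2) le_rfl
    | succ l ih =>
      intro hl
      rw [Finset.sum_range_succ, ← add_assoc]
      have hsub : Set.Ico s (((j0:ℝ) + (l + 1 : ℕ)) * δ) ⊆ Set.Ico s (((j0:ℝ) + l) * δ) ∪
          Set.Ico (((j0:ℝ) + l) * δ) (((j0:ℝ) + l + 1) * δ) := by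
        intro t ht
        have ht2 := ht.2
        push_cast at ht2
        rcases lt_or_ge t (((j0:ℝ) + l) * δ) with h | h
        · exact Or.inl ⟨ht.1, h⟩
        · exact Or.inr ⟨h, by linarith⟩
      refine (lintegral_mono_set hsub).trans ((lintegral_union_le _ _ _).trans ?_)
      refine add_le_add (ih (by omega)) ?_
      calc ∫⁻ t in Set.Ico (((j0:ℝ) + l) * δ) (((j0:ℝ) + l + 1) * δ), g t
          ≤ ∫⁻ t in Set.Ico (((j0:ℝ) + l) * δ) (((j0:ℝ) + l + 1) * δ), c l :=
            setLIntegral_mono' measurableSet_Ico (fun t ht => h2 l (by omega) t ht.1 ht.2)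
        _ = c l * ENNReal.ofReal δ := by
            rw [setLIntegral_const, Real.volume_Ico]
            congr 2; ring
        _ ≤ _ := by rw [mul_comm]
  have := key d le_rfl
  rw [← hT] at this
  rwa [setLIntegral_congr (Ico_ae_eq_Icc (μ := volume) (a := s) (b := T))] at this

lemma aux_int_stepG {Ω : Type*} (m : MeasurableSpace Ω) {m0 : MeasurableSpace Ω} (P : Measure Ω)
    [IsProbabilityMeasure P] (hm : m ≤ m0) (X w Nn : Ω → ℝ) (hX : Measurable[m] X)
    (hw : Measurable w) (hN : Measurable Nn)
    (hind : Indep (MeasurableSpace.comap (fun ω => (w ω, Nn ω)) inferInstance) m P)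
    (A : Set Ω) (hA : MeasurableSet[m] A) (μ σ ρ : ℝ → ℝ) (hμ : Measurable μ)
    (hσ : Measurable σ) (hρ : Measurable ρ) (δ z κ C : ℝ) (hδ : 0 < δ) (hκ : 0 < κ) (hC : 0 < C)
    (hG : ∀ x, ENNReal.ofReal (√(δ + (x - z) ^ 2))
        + ENNReal.ofReal (κ * (δ ^ 2 / ((δ + (x - z) ^ 2) * √(δ + (x - z) ^ 2))))
      ≤ ∫⁻ ω, ENNReal.ofReal (√(δ + ((x - z) + μ x * δ + σ x * w ω + ρ x * Nn ω) ^ 2)) ∂P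
        + ENNReal.ofReal (C * δ * (1 + (x - z) ^ 2))) :
    ∫⁻ ω in A, ENNReal.ofReal (√(δ + (X ω - z) ^ 2)) ∂P
      + ENNReal.ofReal κ * ∫⁻ ω in A, ENNReal.ofReal
          (δ ^ 2 / ((δ + (X ω - z) ^ 2) * √(δ + (X ω - z) ^ 2))) ∂P
      ≤ ∫⁻ ω in A, ENNReal.ofReal
          (√(δ + ((X ω + μ (X ω) * δ + σ (X ω) * w ω + ρ (X ω) * Nn ω) - z) ^ 2)) ∂P
        + ENNReal.ofReal (C * δ) * ∫⁻ ω in A, ENNReal.ofReal (1 + (X ω - z) ^ 2) ∂P := by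
  have hX0 : Measurable X := hX.mono hm le_rfl
  have hf := aux_freeze m P hm X hX (fun ω => (w ω, Nn ω)) (hw.prodMk hN) hind A hA
    (fun q => ENNReal.ofReal (√(δ + ((q.1 - z) + μ q.1 * δ + σ q.1 * q.2.1 + ρ q.1 * q.2.2) ^ 2)))
    (by fun_prop)
  simp only at hf
  have e1 : ∀ ω, (X ω + μ (X ω) * δ + σ (X ω) * w ω + ρ (X ω) * Nn ω) - z
      = (X ω - z) + μ (X ω) * δ + σ (X ω) * w ω + ρ (X ω) * Nn ω := fun ω => by ring
  simp only [e1]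
  rw [hf, ← lintegral_const_mul _ (by fun_prop), ← lintegral_const_mul _ (by fun_prop),
    ← lintegral_add_left (by fun_prop), ← lintegral_add_right _ (by fun_prop)]
  refine lintegral_mono (fun ω => ?_)
  have := hG (X ω)
  rwa [ENNReal.ofReal_mul hκ.le, ENNReal.ofReal_mul (by positivity)] at this

lemma aux_int_stepL2 {Ω : Type*} (m : MeasurableSpace Ω) {m0 : MeasurableSpace Ω} (P : Measure Ω)
    [IsProbabilityMeasure P] (hm : m ≤ m0) (X w Nn : Ω → ℝ) (hX : Measurable[m] X)
    (hw : Measurable w) (hN : Measurable Nn)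
    (hind : Indep (MeasurableSpace.comap (fun ω => (w ω, Nn ω)) inferInstance) m P)
    (A : Set Ω) (hA : MeasurableSet[m] A) (μ σ ρ : ℝ → ℝ) (hμ : Measurable μ)
    (hσ : Measurable σ) (hρ : Measurable ρ) (δ z C : ℝ) (hδ : 0 < δ) (hC : 0 < C)
    (hG : ∀ x, ∫⁻ ω, ENNReal.ofReal (1 + ((x - z) + μ x * δ + σ x * w ω + ρ x * Nn ω) ^ 2) ∂P
        ≤ ENNReal.ofReal ((1 + C * δ) * (1 + (x - z) ^ 2))) :
    ∫⁻ ω in A, ENNReal.ofReal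
          (1 + ((X ω + μ (X ω) * δ + σ (X ω) * w ω + ρ (X ω) * Nn ω) - z) ^ 2) ∂P
        ≤ ENNReal.ofReal (1 + C * δ) * ∫⁻ ω in A, ENNReal.ofReal (1 + (X ω - z) ^ 2) ∂P := by
  have hX0 : Measurable X := hX.mono hm le_rfl
  have hf := aux_freeze m P hm X hX (fun ω => (w ω, Nn ω)) (hw.prodMk hN) hind A hA
    (fun q => ENNReal.ofReal (1 + ((q.1 - z) + μ q.1 * δ + σ q.1 * q.2.1 + ρ q.1 * q.2.2) ^ 2))
    (by fun_prop)
  simp only at hf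
  have e1 : ∀ ω, (X ω + μ (X ω) * δ + σ (X ω) * w ω + ρ (X ω) * Nn ω) - z
      = (X ω - z) + μ (X ω) * δ + σ (X ω) * w ω + ρ (X ω) * Nn ω := fun ω => by ring
  simp only [e1]
  rw [hf, ← lintegral_const_mul _ (by fun_prop)]
  refine lintegral_mono (fun ω => ?_)
  have := hG (X ω)
  rwa [ENNReal.ofReal_mul (by positivity)] at this

lemma aux_int_cross {Ω : Type*} (m : MeasurableSpace Ω) {m0 : MeasurableSpace Ω} (P : Measure Ω)
    [IsProbabilityMeasure P] (hm : m ≤ m0) (X w Nn : Ω → ℝ) (hX : Measurable[m] X)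
    (hw : Measurable w) (hN : Measurable Nn)
    (hind : Indep (MeasurableSpace.comap (fun ω => (w ω, Nn ω)) inferInstance) m P)
    (A : Set Ω) (hA : MeasurableSet[m] A) (μ σ ρ : ℝ → ℝ) (hμ : Measurable μ)
    (hσ : Measurable σ) (hρ : Measurable ρ) (h z : ℝ) (G : ℝ → ENNReal)
    (hG : ∀ x, P {ω | (x - z) * ((x - z) + μ x * h + σ x * w ω + ρ x * Nn ω) ≤ 0} ≤ G x) :
    P (A ∩ {ω | (X ω - z) * ((X ω + μ (X ω) * h + σ (X ω) * w ω + ρ (X ω) * Nn ω) - z) ≤ 0})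
        ≤ ∫⁻ ω in A, G (X ω) ∂P := by
  have hX0 : Measurable X := hX.mono hm le_rfl
  set S : Set (ℝ × (ℝ × ℝ)) :=
    {q | (q.1 - z) * ((q.1 - z) + μ q.1 * h + σ q.1 * q.2.1 + ρ q.1 * q.2.2) ≤ 0} with hS
  have hSm : MeasurableSet S := measurableSet_le (by fun_prop) measurable_const
  have hf := aux_freeze m P hm X hX (fun ω => (w ω, Nn ω)) (hw.prodMk hN) hind A hA
    (S.indicator 1) (measurable_one.indicator hSm)
  have hB : MeasurableSet {ω | (X ω, (w ω, Nn ω)) ∈ S} :=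
    (hX0.prodMk (hw.prodMk hN)) hSm
  have e1 : A ∩ {ω | (X ω - z) * ((X ω + μ (X ω) * h + σ (X ω) * w ω + ρ (X ω) * Nn ω) - z) ≤ 0}
      = {ω | (X ω, (w ω, Nn ω)) ∈ S} ∩ A := by
    rw [Set.inter_comm]
    congr 1
    ext ω
    simp only [hS, Set.mem_ofPred_eq]
    rw [show (X ω + μ (X ω) * h + σ (X ω) * w ω + ρ (X ω) * Nn ω) - z
      = (X ω - z) + μ (X ω) * h + σ (X ω) * w ω + ρ (X ω) * Nn ω by ring]
  rw [e1, ← Measure.restrict_apply hB, ← lintegral_indicator_one hB]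
  have e2 : ∀ ω, ({ω | (X ω, (w ω, Nn ω)) ∈ S}.indicator (1 : Ω → ENNReal)) ω
      = S.indicator 1 (X ω, (w ω, Nn ω)) := fun ω => by
    simp [Set.indicator]
  simp only [e2]
  rw [hf]
  refine lintegral_mono (fun ω => ?_)
  refine le_trans (le_of_eq ?_) (hG (X ω))
  have hBx : MeasurableSet {ω' | (X ω, (w ω', Nn ω')) ∈ S} :=
    (measurable_const.prodMk (hw.prodMk hN)) hSm
  change _ = P {ω' | (X ω, (w ω', Nn ω')) ∈ S}
  rw [← lintegral_indicator_one hBx]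
  refine lintegral_congr (fun ω' => ?_)
  simp [Set.indicator]

lemma aux_sqrt_le_one (δ y : ℝ) (hδ1 : δ ≤ 1) : √(δ + y ^ 2) ≤ 1 + y ^ 2 := by
  rw [Real.sqrt_le_left (by positivity)]
  nlinarith [sq_nonneg y, sq_nonneg (y ^ 2)]

lemma aux_algebra (pA b0 sp : ENNReal) (K κ M T δ : ℝ) (d : ℕ) (hK : 0 < K) (hκ : 0 < κ)
    (hM : 0 ≤ M) (hδ : 0 < δ) (hδ1 : δ ≤ 1) (hd : (d:ℝ) * δ ≤ T) (hp : pA ≤ b0)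
    (hs : ENNReal.ofReal κ * sp ≤ ENNReal.ofReal M * b0) :
    ENNReal.ofReal δ * pA + (ENNReal.ofReal (K * √δ) * sp + (d:ENNReal) * (ENNReal.ofReal (K * δ ^ 2) * pA))
      ≤ ENNReal.ofReal ((1 + K * T + K * M / κ) * √δ) * b0 := by
  have hT : 0 ≤ T := le_trans (by positivity) hd
  have hsq : δ ≤ √δ := by
    exact Real.le_sqrt_of_sq_le (by nlinarith)
  have e1 : ENNReal.ofReal (K * √δ) * sp ≤ ENNReal.ofReal (K * M / κ * √δ) * b0 := by
    calc ENNReal.ofReal (K * √δ) * sp = ENNReal.ofReal (K * √δ / κ) * (ENNReal.ofReal κ * sp) := by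
          rw [← mul_assoc, ← ENNReal.ofReal_mul (by positivity)]
          congr 2; field_simp
      _ ≤ ENNReal.ofReal (K * √δ / κ) * (ENNReal.ofReal M * b0) := mul_le_mul' le_rfl hs
      _ = _ := by
          rw [← mul_assoc, ← ENNReal.ofReal_mul (by positivity)]
          congr 2; field_simp
  have e2 : (d:ENNReal) * (ENNReal.ofReal (K * δ ^ 2) * pA) ≤ ENNReal.ofReal (K * T * √δ) * b0 := by
    rw [← mul_assoc, ← ENNReal.ofReal_natCast d, ← ENNReal.ofReal_mul (by positivity)]
    refine mul_le_mul' (ENNReal.ofReal_le_ofReal ?_) hp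
    calc (d:ℝ) * (K * δ ^ 2) = K * (d * δ) * δ := by ring
      _ ≤ K * T * √δ := by gcongr
  have e3 : ENNReal.ofReal δ * pA ≤ ENNReal.ofReal (√δ) * b0 :=
    mul_le_mul' (ENNReal.ofReal_le_ofReal hsq) hp
  refine (add_le_add e3 (add_le_add e1 e2)).trans (le_of_eq ?_)
  rw [← add_mul, ← add_mul, ← ENNReal.ofReal_add (by positivity) (by positivity),
    ← ENNReal.ofReal_add (by positivity) (by positivity)]
  congr 2; ring

lemma aux_final
    {Ω : Type*} {m0 : MeasurableSpace Ω}
    (F : Filtration ℝ m0) (P : Measure Ω) [IsProbabilityMeasure P]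
    (T : ℝ) (hT : 0 < T)
    (lam : ℝ → ℝ)
    (hlam_pos : ∀ t ∈ Set.Icc (0:ℝ) T, 0 < lam t)
    (lamB : ℝ) (hlamB : ∀ t ∈ Set.Icc (0:ℝ) T, lam t ≤ lamB)
    (W N : ℝ → Ω → ℝ)
    (hW_adapted : ∀ t ∈ Set.Icc (0:ℝ) T, Measurable[F t] (W t))
    (hN_adapted : ∀ t ∈ Set.Icc (0:ℝ) T, Measurable[F t] (N t))
    (hW_gauss : ∀ s t : ℝ, 0 ≤ s → s ≤ t → t ≤ T →
      Measure.map (fun ω => W t ω - W s ω) P = gaussianReal 0 (Real.toNNReal (t - s)))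
    (hN_poisson : ∀ s t : ℝ, 0 ≤ s → s ≤ t → t ≤ T →
      Measure.map (fun ω => N t ω - N s ω) P
        = Measure.map (fun k : ℕ => (k : ℝ))
            (poissonMeasure (Real.toNNReal (∫ u in s..t, lam u))))
    (h_indep : ∀ s t : ℝ, 0 ≤ s → s ≤ t → t ≤ T →
      Indep (MeasurableSpace.comap (fun ω => (W t ω - W s ω, N t ω - N s ω)) inferInstance)
        (F s) P)
    (μ σ ρ : ℝ → ℝ) (hμ_meas : Measurable μ) (hσ_meas : Measurable σ) (hρ_meas : Measurable ρ)
    (z : ℝ) (hμ : ∃ L : ℝ, ∀ x, |μ x| ≤ L * (1 + |x|))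
    (hσ_lip : ∃ K : NNReal, LipschitzWith K σ)
    (hσ_nz : σ z ≠ 0)
    (hρ_lip : ∃ K : NNReal, LipschitzWith K ρ)
    (ξ : ℝ) :
    ∃ C : ℝ, 0 < C ∧ ∀ n : ℕ, 0 < n → T / n ≤ 1 →
      ∀ (s : ℝ), s ∈ Set.Ico (0:ℝ) T →
      ∫⁻ t in Set.Icc s T,
          P (crossEvent μ σ ρ W N (T / n) ξ z s ∩ crossEvent μ σ ρ W N (T / n) ξ z t)
        ≤ ENNReal.ofReal (C * Real.sqrt (T / n)) *
            (P (crossEvent μ σ ρ W N (T / n) ξ z s)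
              + ∫⁻ ω in crossEvent μ σ ρ W N (T / n) ξ z s,
                  ENNReal.ofReal
                    ((emProc μ σ ρ W N (T / n) ξ (lastGrid (T / n) s + T / n) ω - z) ^ 2) ∂P) := by
  obtain ⟨L1, hL1, hμL⟩ := aux_lin_center μ z hμ
  obtain ⟨L2, hL2, hσL⟩ := aux_lin_center σ z (aux_lin_lipschitz σ hσ_lip)
  obtain ⟨L3, hL3, hρL⟩ := aux_lin_center ρ z (aux_lin_lipschitz ρ hρ_lip)
  obtain ⟨ε, c, hε, hc, hσc⟩ := aux_sigma_low σ z hσ_lip hσ_nz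
  set L : ℝ := L1 + L2 + L3 with hLdef
  have hL : 0 ≤ L := by positivity
  replace hμL : ∀ x, |μ x| ≤ L * (1 + |x - z|) := fun x =>
    (hμL x).trans (mul_le_mul_of_nonneg_right (by rw [hLdef]; linarith) (by positivity))
  replace hσL : ∀ x, |σ x| ≤ L * (1 + |x - z|) := fun x =>
    (hσL x).trans (mul_le_mul_of_nonneg_right (by rw [hLdef]; linarith) (by positivity))
  replace hρL : ∀ x, |ρ x| ≤ L * (1 + |x - z|) := fun x =>
    (hρL x).trans (mul_le_mul_of_nonneg_right (by rw [hLdef]; linarith) (by positivity))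
  have hΛ : 0 ≤ |lamB| + |lamB| ^ 2 := by positivity
  obtain ⟨κ, C, hκ, hC, stepG⟩ := aux_stepG L (|lamB| + |lamB| ^ 2) ε c hL hΛ hε hc
  obtain ⟨C', hC', stepL2⟩ := aux_stepL2 L (|lamB| + |lamB| ^ 2) hL hΛ
  obtain ⟨K, hK, cross⟩ := aux_cross L (|lamB| + |lamB| ^ 2) hL hΛ
  set M : ℝ := (1 + C * T) * Real.exp (C' * T) with hM
  have hM0 : 0 ≤ M := by positivity
  refine ⟨1 + K * T + K * M / κ, by positivity, ?_⟩
  intro n hn hδ1 s hs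
  have hn0 : (0:ℝ) < n := by exact_mod_cast hn
  set δ : ℝ := T / n with hδdef
  have hδ : 0 < δ := by positivity
  have hnδ : (n:ℝ) * δ = T := by rw [hδdef]; field_simp
  -- grid index of `s`
  obtain ⟨j, hj1, hj2⟩ : ∃ j : ℕ, (j:ℝ) * δ ≤ s ∧ s < ((j:ℝ) + 1) * δ := by
    refine ⟨⌊s / δ⌋₊, ?_, ?_⟩
    · rw [← le_div_iff₀ hδ]; exact Nat.floor_le (div_nonneg hs.1 hδ.le)
    · rw [← div_lt_iff₀ hδ]; exact Nat.lt_floor_add_one _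
  have hjn : j < n := by
    have : (j:ℝ) * δ < n * δ := by rw [hnδ]; exact lt_of_le_of_lt hj1 hs.2
    exact_mod_cast lt_of_mul_lt_mul_right this hδ.le
  obtain ⟨d, hd⟩ : ∃ d, n = j + 1 + d := ⟨n - (j + 1), by omega⟩
  have hle : ∀ q : ℕ, q ≤ n → (q:ℝ) * δ ≤ T := fun q hq => by
    rw [← hnδ]
    have : (q:ℝ) ≤ n := by exact_mod_cast hq
    exact mul_le_mul_of_nonneg_right this hδ.le
  have hWm : ∀ t ∈ Set.Icc (0:ℝ) T, Measurable (W t) := fun t ht =>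
    (hW_adapted t ht).mono (F.le t) le_rfl
  have hNm : ∀ t ∈ Set.Icc (0:ℝ) T, Measurable (N t) := fun t ht =>
    (hN_adapted t ht).mono (F.le t) le_rfl
  have hXm : ∀ q : ℕ, q ≤ n → Measurable[F ((q:ℝ) * δ)] (emGrid μ σ ρ W N δ ξ q) := fun q hq =>
    aux_emGrid_meas F T W N hW_adapted hN_adapted μ σ ρ hμ_meas hσ_meas hρ_meas δ ξ hδ q (hle q hq)
  have hXm0 : ∀ q : ℕ, q ≤ n → Measurable (emGrid μ σ ρ W N δ ξ q) := fun q hq =>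
    (hXm q hq).mono (F.le _) le_rfl
  set A : Set Ω := crossEvent μ σ ρ W N δ ξ z s with hAdef
  have hj0 : 0 ≤ (j:ℝ) * δ := by positivity
  have hAs : MeasurableSet[F s] A := by
    rw [hAdef, aux_cross_eq μ σ ρ W N δ ξ z s hδ j hj1 hj2]
    have hF := F.mono hj1
    have hXs := (hXm j hjn.le).mono hF le_rfl
    have hjT : (j:ℝ) * δ ∈ Set.Icc (0:ℝ) T := ⟨hj0, hle j hjn.le⟩
    exact aux_meas_set (m := F s) _ _ hXs (aux_meas_step (m := F s) μ σ ρ hμ_meas hσ_meas hρ_meas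
      _ _ _ _ _ hXs (hW_adapted s ⟨hs.1, hs.2.le⟩) ((hW_adapted _ hjT).mono hF le_rfl)
      (hN_adapted s ⟨hs.1, hs.2.le⟩) ((hN_adapted _ hjT).mono hF le_rfl) _) z
  have hAq : ∀ q : ℕ, j + 1 ≤ q → MeasurableSet[F ((q:ℝ) * δ)] A := fun q hq => by
    refine F.mono ?_ _ hAs
    have : (j:ℝ) + 1 ≤ q := by exact_mod_cast hq
    exact hj2.le.trans (mul_le_mul_of_nonneg_right this hδ.le)
  have hA0 : MeasurableSet A := F.le s _ hAs
  -- increments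
  have hinc : ∀ u t : ℝ, 0 ≤ u → u ≤ t → t ≤ T → t - u ≤ δ →
      Measurable (fun ω => W t ω - W u ω) ∧ Measurable (fun ω => N t ω - N u ω) ∧
      Integrable (fun ω => (N t ω - N u ω) ^ 2) P ∧
      ∫ ω, (N t ω - N u ω) ^ 2 ∂P ≤ (|lamB| + |lamB| ^ 2) * δ ∧
      ∀ᵐ ω ∂P, N t ω - N u ω = 0 ∨ 1 ≤ N t ω - N u ω := by
    intro u t hu hut ht htu
    have h1 := (hWm t ⟨hu.trans hut, ht⟩).sub (hWm u ⟨hu, hut.trans ht⟩)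
    have h2 := (hNm t ⟨hu.trans hut, ht⟩).sub (hNm u ⟨hu, hut.trans ht⟩)
    exact ⟨h1, h2, aux_N_facts P T lam hlam_pos lamB hlamB (fun ω => N t ω - N u ω) h2 u t δ hu hut
      ht htu hδ1 (hN_poisson u t hu hut ht)⟩
  have hgrid : ∀ q : ℕ, q < n → 0 ≤ (q:ℝ) * δ ∧ (q:ℝ) * δ ≤ ((q:ℝ) + 1) * δ ∧
      ((q:ℝ) + 1) * δ ≤ T ∧ ((q:ℝ) + 1) * δ - (q:ℝ) * δ = δ := fun q hq => by
    refine ⟨by positivity, by linarith, ?_, by ring⟩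
    have := hle (q + 1) hq
    push_cast at this; exact this
  set Y : ℕ → Ω → ℝ := fun q => emGrid μ σ ρ W N δ ξ q with hY
  have hYs : ∀ q ω, Y (q + 1) ω = Y q ω + μ (Y q ω) * δ
      + σ (Y q ω) * (W (((q : ℝ) + 1) * δ) ω - W ((q : ℝ) * δ) ω)
      + ρ (Y q ω) * (N (((q : ℝ) + 1) * δ) ω - N ((q : ℝ) * δ) ω) := fun q ω => rfl
  set a : ℕ → ENNReal := fun i => ∫⁻ ω in A, ENNReal.ofReal (√(δ + (Y (j + 1 + i) ω - z) ^ 2)) ∂P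
    with ha
  set b : ℕ → ENNReal := fun i => ∫⁻ ω in A, ENNReal.ofReal (1 + (Y (j + 1 + i) ω - z) ^ 2) ∂P
    with hb
  set p : ℕ → ENNReal := fun i => ∫⁻ ω in A, ENNReal.ofReal
    (δ ^ 2 / ((δ + (Y (j + 1 + i) ω - z) ^ 2) * √(δ + (Y (j + 1 + i) ω - z) ^ 2))) ∂P with hp
  have h1 : ∀ i < d, a i + ENNReal.ofReal κ * p i ≤ a (i + 1) + ENNReal.ofReal (C * δ) * b i := by
    intro i hi
    obtain ⟨g1, g2, g3, g4⟩ := hgrid (j + 1 + i) (by omega)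
    obtain ⟨m1, m2, m3, m4, m5⟩ := hinc _ _ g1 g2 g3 g4.le
    have hg := hW_gauss _ _ g1 g2 g3
    rw [g4] at hg
    have := aux_int_stepG (F (((j + 1 + i : ℕ):ℝ) * δ)) P (F.le _) (Y (j + 1 + i)) _ _
      (hXm _ (by omega)) m1 m2 (h_indep _ _ g1 g2 g3) A (hAq _ (by omega)) μ σ ρ hμ_meas hσ_meas
      hρ_meas δ z κ C hδ hκ hC
      (fun x => stepG P _ _ m1 m2 δ hδ hδ1 hg m3 m4 m5 (x - z) (μ x) (σ x) (ρ x) (hμL x) (hρL x)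
        (hσc x))
    exact this
  have h2 : ∀ i < d, b (i + 1) ≤ ENNReal.ofReal (1 + C' * δ) * b i := by
    intro i hi
    obtain ⟨g1, g2, g3, g4⟩ := hgrid (j + 1 + i) (by omega)
    obtain ⟨m1, m2, m3, m4, m5⟩ := hinc _ _ g1 g2 g3 g4.le
    have hg := hW_gauss _ _ g1 g2 g3
    rw [g4] at hg
    have := aux_int_stepL2 (F (((j + 1 + i : ℕ):ℝ) * δ)) P (F.le _) (Y (j + 1 + i)) _ _
      (hXm _ (by omega)) m1 m2 (h_indep _ _ g1 g2 g3) A (hAq _ (by omega)) μ σ ρ hμ_meas hσ_meas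
      hρ_meas δ z C' hδ hC'
      (fun x => stepL2 P _ _ m1 m2 δ hδ hδ1 hg m3 m4 m5 (x - z) (μ x) (σ x) (ρ x) (hμL x) (hσL x)
        (hρL x))
    exact this
  have h3 : ∀ i ≤ d, a i ≤ b i := fun i _ =>
    lintegral_mono (fun ω => ENNReal.ofReal_le_ofReal (aux_sqrt_le_one δ _ hδ1))
  have hdT : (d:ℝ) * δ ≤ T := hle d (by omega)
  have htel := aux_telescope a b p κ C C' δ T hC.le hC'.le hδ.le d hdT h1 h2 h3
  -- crossing probabilities
  have hcr : ∀ i < d, ∀ t, (((j + 1 : ℕ):ℝ) + i) * δ ≤ t → t < (((j + 1 : ℕ):ℝ) + i + 1) * δ →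
      P (A ∩ crossEvent μ σ ρ W N δ ξ z t) ≤ ∫⁻ ω in A, ENNReal.ofReal (K * (δ * √δ /
        ((δ + (Y (j + 1 + i) ω - z) ^ 2) * √(δ + (Y (j + 1 + i) ω - z) ^ 2)) + δ)) ∂P := by
    intro i hi t ht1 ht2
    have hcast : ((j + 1 : ℕ):ℝ) + i = ((j + 1 + i : ℕ):ℝ) := by push_cast; ring
    rw [hcast] at ht1 ht2
    obtain ⟨g1, g2, g3, g4⟩ := hgrid (j + 1 + i) (by omega)
    have htT : t ≤ T := ht2.le.trans g3
    have htd : t - ((j + 1 + i : ℕ):ℝ) * δ ≤ δ := by linarith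
    obtain ⟨m1, m2, m3, m4, m5⟩ := hinc _ _ g1 ht1 htT htd
    have hg := hW_gauss _ _ g1 ht1 htT
    rw [aux_cross_eq μ σ ρ W N δ ξ z t hδ (j + 1 + i) ht1 ht2]
    exact aux_int_cross (F (((j + 1 + i : ℕ):ℝ) * δ)) P (F.le _) (Y (j + 1 + i)) _ _
      (hXm _ (by omega)) m1 m2 (h_indep _ _ g1 ht1 htT) A (hAq _ (by omega)) μ σ ρ hμ_meas hσ_meas
      hρ_meas _ z (fun x => ENNReal.ofReal (K * (δ * √δ /
        ((δ + (x - z) ^ 2) * √(δ + (x - z) ^ 2)) + δ)))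
      (fun x => cross P _ _ m1 m2 _ δ (sub_nonneg.2 ht1) htd hδ hδ1 hg m3 m4 m5 (x - z) (μ x) (σ x)
        (ρ x) (hμL x) (hσL x))
  have hTd : T = (((j + 1 : ℕ):ℝ) + d) * δ := by
    rw [← hnδ, hd]; push_cast; ring
  have htime := aux_time (fun t => P (A ∩ crossEvent μ σ ρ W N δ ξ z t)) δ s T hδ (j + 1) d hTd
    (by push_cast; exact hj2.le) (by push_cast; linarith) (P A) _
    (fun t => measure_mono Set.inter_subset_left) hcr
  refine htime.trans ?_
  have hYm : ∀ i < d, Measurable (Y (j + 1 + i)) := fun i hi => hXm0 _ (by omega)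
  have hci : ∀ i ∈ Finset.range d, ENNReal.ofReal δ * ∫⁻ ω in A, ENNReal.ofReal (K * (δ * √δ /
        ((δ + (Y (j + 1 + i) ω - z) ^ 2) * √(δ + (Y (j + 1 + i) ω - z) ^ 2)) + δ)) ∂P
      = ENNReal.ofReal (K * √δ) * p i + ENNReal.ofReal (K * δ ^ 2) * P A := by
    intro i hi
    have hYi := hYm i (Finset.mem_range.1 hi)
    have e : P A = ∫⁻ ω in A, 1 ∂P := by simp
    rw [e, hp, ← lintegral_const_mul _ (by fun_prop), ← lintegral_const_mul _ (by fun_prop),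
      ← lintegral_const_mul _ (by fun_prop), ← lintegral_add_left (by fun_prop)]
    refine lintegral_congr (fun ω => ?_)
    have hD : 0 < δ + (Y (j + 1 + i) ω - z) ^ 2 := by positivity
    rw [mul_one, ← ENNReal.ofReal_mul hδ.le, ← ENNReal.ofReal_mul (by positivity),
      ← ENNReal.ofReal_add (by positivity) (by positivity)]
    congr 1
    ring
  rw [Finset.sum_congr rfl hci, Finset.sum_add_distrib, ← Finset.mul_sum, Finset.sum_const,
    Finset.card_range, nsmul_eq_mul]
  have hb0 : b 0 = P A + ∫⁻ ω in A, ENNReal.ofReal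
      ((emProc μ σ ρ W N δ ξ (lastGrid δ s + δ) ω - z) ^ 2) ∂P := by
    have hlast : lastGrid δ s + δ = ((j + 1 : ℕ):ℝ) * δ := by
      unfold lastGrid
      rw [aux_floor δ s hδ j hj1 hj2]; push_cast; ring
    rw [hlast]
    simp only [aux_emProc_grid μ σ ρ W N δ ξ hδ (j + 1)]
    have e : P A = ∫⁻ ω in A, 1 ∂P := by simp
    rw [e, ← lintegral_add_left measurable_const]
    refine lintegral_congr (fun ω => ?_)
    rw [ENNReal.ofReal_add zero_le_one (sq_nonneg _), ENNReal.ofReal_one]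
  rw [← hb0]
  exact aux_algebra (P A) (b 0) _ K κ M T δ d hK hκ hM0 hδ hδ1 hdT (by rw [hb0]; exact le_self_add)
    htel

/-- Integrated crossing probability estimate:
`∫_s^T P(Z_k^s ∩ Z_k^t) dt ≤ C₂ δ^{1/2} (P(Z_k^s) + E[1_{Z_k^s} (X^{(δ)}_{s̲+δ} - ζ_k)²])`. -/
theorem em_integrated_crossing_probability
    {Ω : Type*} {m0 : MeasurableSpace Ω}
    (F : Filtration ℝ m0) (P : Measure Ω) [IsProbabilityMeasure P]
    (T : ℝ) (hT : 0 < T)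
    (lam : ℝ → ℝ) (hlam_meas : Measurable lam)
    (hlam_pos : ∀ t ∈ Set.Icc (0:ℝ) T, 0 < lam t)
    (lamB : ℝ) (hlamB : ∀ t ∈ Set.Icc (0:ℝ) T, lam t ≤ lamB)
    (W N : ℝ → Ω → ℝ)
    (hW0 : ∀ ω, W 0 ω = 0) (hN0 : ∀ ω, N 0 ω = 0)
    (hW_adapted : ∀ t ∈ Set.Icc (0:ℝ) T, Measurable[F t] (W t))
    (hN_adapted : ∀ t ∈ Set.Icc (0:ℝ) T, Measurable[F t] (N t))
    (hW_cont : ∀ᵐ ω ∂P, ContinuousOn (fun t => W t ω) (Set.Icc 0 T))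
    (hN_mono : ∀ᵐ ω ∂P, ∀ s t : ℝ, 0 ≤ s → s ≤ t → t ≤ T → N s ω ≤ N t ω)
    (hN_rc : ∀ᵐ ω ∂P, ∀ t ∈ Set.Ico (0:ℝ) T,
      Filter.Tendsto (fun u => N u ω) (nhdsWithin t (Set.Ioi t)) (nhds (N t ω)))
    (hN_int : ∀ᵐ ω ∂P, ∀ t ∈ Set.Icc (0:ℝ) T, ∃ k : ℕ, N t ω = k)
    (hW_gauss : ∀ s t : ℝ, 0 ≤ s → s ≤ t → t ≤ T →
      Measure.map (fun ω => W t ω - W s ω) P = gaussianReal 0 (Real.toNNReal (t - s)))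
    (hN_poisson : ∀ s t : ℝ, 0 ≤ s → s ≤ t → t ≤ T →
      Measure.map (fun ω => N t ω - N s ω) P
        = Measure.map (fun k : ℕ => (k : ℝ))
            (poissonMeasure (Real.toNNReal (∫ u in s..t, lam u))))
    (h_indep : ∀ s t : ℝ, 0 ≤ s → s ≤ t → t ≤ T →
      Indep (MeasurableSpace.comap (fun ω => (W t ω - W s ω, N t ω - N s ω)) inferInstance)
        (F s) P)
    (hWN_indep : ∀ s t : ℝ, 0 ≤ s → s ≤ t → t ≤ T →
      IndepFun (fun ω => W t ω - W s ω) (fun ω => N t ω - N s ω) P)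
    (μ σ ρ : ℝ → ℝ) (hμ_meas : Measurable μ) (hσ_meas : Measurable σ) (hρ_meas : Measurable ρ)
    (m : ℕ) (hm : 0 < m) (ζ : Fin m → ℝ) (hζ : StrictMono ζ)
    (hμ_low : ∃ K : NNReal, LipschitzOnWith K μ (Set.Iio (ζ ⟨0, hm⟩)))
    (hμ_high : ∃ K : NNReal, LipschitzOnWith K μ (Set.Ioi (ζ ⟨m - 1, Nat.sub_lt hm one_pos⟩)))
    (hμ_mid : ∀ (k : Fin m) (h : (k : ℕ) + 1 < m),
      ∃ K : NNReal, LipschitzOnWith K μ (Set.Ioo (ζ k) (ζ ⟨(k : ℕ) + 1, h⟩)))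
    (hσ_lip : ∃ K : NNReal, LipschitzWith K σ)
    (hσ_nz : ∀ k : Fin m, σ (ζ k) ≠ 0)
    (hρ_lip : ∃ K : NNReal, LipschitzWith K ρ)
    (ξ : ℝ) :
    ∃ C : ℝ, 0 < C ∧ ∃ δ0 : ℝ, δ0 ∈ Set.Ioo (0:ℝ) 1 ∧ ∀ n : ℕ, 0 < n → T / n < δ0 →
      ∀ (k : Fin m) (s : ℝ), s ∈ Set.Ico (0:ℝ) T →
      ∫⁻ t in Set.Icc s T,
          P (crossEvent μ σ ρ W N (T / n) ξ (ζ k) s ∩ crossEvent μ σ ρ W N (T / n) ξ (ζ k) t)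
        ≤ ENNReal.ofReal (C * Real.sqrt (T / n)) *
            (P (crossEvent μ σ ρ W N (T / n) ξ (ζ k) s)
              + ∫⁻ ω in crossEvent μ σ ρ W N (T / n) ξ (ζ k) s,
                  ENNReal.ofReal
                    ((emProc μ σ ρ W N (T / n) ξ (lastGrid (T / n) s + T / n) ω - ζ k) ^ 2) ∂P) := by
  have hμ := aux_mu_lin μ m hm ζ hμ_low hμ_high hμ_mid
  have key := fun k : Fin m => aux_final F P T hT lam hlam_pos lamB hlamB W N hW_adapted hN_adapted
    hW_gauss hN_poisson h_indep μ σ ρ hμ_meas hσ_meas hρ_meas (ζ k) hμ hσ_lip (hσ_nz k) hρ_lip ξ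
  choose C hC hkey using key
  have hle : ∀ k, C k ≤ ∑ l, C l := fun k =>
    Finset.single_le_sum (fun l _ => (hC l).le) (Finset.mem_univ k)
  refine ⟨∑ l, C l, (hC ⟨0, hm⟩).trans_le (hle _), 1 / 2, by norm_num, ?_⟩
  intro n hn hδ k s hs
  refine (hkey k n hn (by linarith) s hs).trans ?_
  exact mul_le_mul' (ENNReal.ofReal_le_ofReal
    (mul_le_mul_of_nonneg_right (hle k) (Real.sqrt_nonneg _))) le_rfl
end

section
/- There exists a constant C_3 ∈ (0,∞) such that for every n ∈ ℕ with δ = T/n ∈ (0,1) and every k ∈ {1,…,m}, it holds that ∫_0^T E[ 1_{Z_k^s} · (X^{(δ)}_{s̲+δ} − ζ_k)^2 ] ds ≤ C_3 δ (the integrand being understood for s ∈ [0,T), so that s̲ + δ ≤ T). -/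
open MeasureTheory ProbabilityTheory

/-- linear growth on a set -/
def GrowthOn (f : ℝ → ℝ) (S : Set ℝ) : Prop :=
  ∃ c : ℝ, 0 ≤ c ∧ ∀ x ∈ S, |f x| ≤ c * (1 + |x|)

lemma GrowthOn.union {f : ℝ → ℝ} {S S' : Set ℝ} (h : GrowthOn f S) (h' : GrowthOn f S') :
    GrowthOn f (S ∪ S') := by
  obtain ⟨c, hc, h⟩ := h
  obtain ⟨c', hc', h'⟩ := h'
  refine ⟨c + c', by positivity, ?_⟩
  rintro x (hx | hx)
  · have := h x hx
    have h2 : 0 ≤ c' * (1 + |x|) := by positivity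
    linarith
  · have := h' x hx
    have h2 : 0 ≤ c * (1 + |x|) := by positivity
    linarith

lemma GrowthOn.mono {f : ℝ → ℝ} {S S' : Set ℝ} (h : GrowthOn f S) (hs : S' ⊆ S) :
    GrowthOn f S' := by
  obtain ⟨c, hc, h⟩ := h
  exact ⟨c, hc, fun x hx => h x (hs hx)⟩

lemma growthOn_singleton (f : ℝ → ℝ) (a : ℝ) : GrowthOn f {a} := by
  refine ⟨|f a|, abs_nonneg _, ?_⟩
  rintro x rfl
  have := mul_nonneg (abs_nonneg (f x)) (abs_nonneg x)
  linarith

lemma growthOn_of_lipschitzOn {f : ℝ → ℝ} {S : Set ℝ} (h : ∃ K : NNReal, LipschitzOnWith K f S) :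
    GrowthOn f S := by
  obtain ⟨K, h⟩ := h
  rcases S.eq_empty_or_nonempty with rfl | ⟨a, ha⟩
  · exact ⟨0, le_rfl, by simp⟩
  · refine ⟨|f a| + K * (1 + |a|), by positivity, fun x hx => ?_⟩
    have h1 := h.dist_le_mul x hx a ha
    rw [Real.dist_eq, Real.dist_eq] at h1
    have h2 : |f x| ≤ |f x - f a| + |f a| := by
      have := abs_add_le (f x - f a) (f a); simpa using this
    have h3 : |x - a| ≤ |x| + |a| := abs_sub x a
    have hK : (0:ℝ) ≤ K := K.2
    have h4 : (K:ℝ) * |x - a| ≤ K * (|x| + |a|) := by gcongr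
    have h5 := mul_nonneg (abs_nonneg (f a)) (abs_nonneg x)
    have h6 := mul_nonneg hK (mul_nonneg (abs_nonneg a) (abs_nonneg x))
    nlinarith

lemma growthOn_sq {f : ℝ → ℝ} (h : GrowthOn f Set.univ) :
    ∃ K : ℝ, 0 ≤ K ∧ ∀ x, f x ^ 2 ≤ K * (1 + x ^ 2) := by
  obtain ⟨c, hc, h⟩ := h
  refine ⟨2 * c ^ 2, by positivity, fun x => ?_⟩
  have h1 := h x trivial
  have h2 : |f x| ^ 2 ≤ (c * (1 + |x|)) ^ 2 := by gcongr
  rw [sq_abs] at h2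
  have h3 : (1 + |x|) ^ 2 ≤ 2 * (1 + x ^ 2) := by
    have := sq_abs x
    nlinarith [sq_nonneg (1 - |x|)]
  calc f x ^ 2 ≤ (c * (1 + |x|)) ^ 2 := h2
    _ = c ^ 2 * (1 + |x|) ^ 2 := by ring
    _ ≤ c ^ 2 * (2 * (1 + x ^ 2)) := by gcongr
    _ = _ := by ring

lemma growth_piecewise {μ : ℝ → ℝ} (m : ℕ) (hm : 0 < m) (ζ : Fin m → ℝ)
    (hμ_low : ∃ K : NNReal, LipschitzOnWith K μ (Set.Iio (ζ ⟨0, hm⟩)))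
    (hμ_high : ∃ K : NNReal, LipschitzOnWith K μ (Set.Ioi (ζ ⟨m - 1, Nat.sub_lt hm one_pos⟩)))
    (hμ_mid : ∀ (k : Fin m) (h : (k : ℕ) + 1 < m),
      ∃ K : NNReal, LipschitzOnWith K μ (Set.Ioo (ζ k) (ζ ⟨(k : ℕ) + 1, h⟩))) :
    GrowthOn μ Set.univ := by
  have key : ∀ k : ℕ, ∀ h : k < m, GrowthOn μ (Set.Iic (ζ ⟨k, h⟩)) := by
    intro k
    induction k with
    | zero =>
      intro h
      refine ((growthOn_of_lipschitzOn hμ_low).union (growthOn_singleton μ (ζ ⟨0, hm⟩))).mono ?_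
      intro x hx
      rcases lt_or_eq_of_le (show x ≤ _ from hx) with h | h
      · exact Or.inl h
      · exact Or.inr h
    | succ k ih =>
      intro h
      refine (((ih (by omega)).union (growthOn_of_lipschitzOn (hμ_mid ⟨k, by omega⟩ h))).union
        (growthOn_singleton μ (ζ ⟨k + 1, h⟩))).mono ?_
      intro x hx
      rcases lt_or_eq_of_le (show x ≤ _ from hx) with h | h
      · rcases le_or_gt x (ζ ⟨k, by omega⟩) with h' | h'
        · exact Or.inl (Or.inl h')
        · exact Or.inl (Or.inr ⟨h', h⟩)
      · exact Or.inr h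
  refine ((key (m - 1) (Nat.sub_lt hm one_pos)).union (growthOn_of_lipschitzOn hμ_high)).mono ?_
  intro x _
  exact le_or_gt x _

lemma poisson_hasSum_one (r : NNReal) :
    HasSum (fun n : ℕ => Real.exp (-r) * (r:ℝ) ^ n / (n.factorial : ℝ) * (n : ℝ)) r := by
  rw [← hasSum_nat_add_iff' 1]
  have h := (hasSum_one_poissonMeasure r).mul_left (r:ℝ)
  rw [Finset.sum_range_one, Nat.cast_zero, mul_zero, sub_zero]
  rw [mul_one] at h
  refine (congrArg (fun f => HasSum f _) (funext fun n => ?_)).mpr h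
  rw [Nat.factorial_succ]
  push_cast
  field_simp
  ring

lemma poisson_hasSum_two (r : NNReal) :
    HasSum (fun n : ℕ => Real.exp (-r) * (r:ℝ) ^ n / (n.factorial : ℝ) * (n : ℝ) ^ 2)
      (r + r ^ 2) := by
  rw [← hasSum_nat_add_iff' 1]
  have h := ((hasSum_one_poissonMeasure r).add (poisson_hasSum_one r)).mul_left (r:ℝ)
  rw [Finset.sum_range_one, Nat.cast_zero, zero_pow two_ne_zero, mul_zero, sub_zero]
  rw [show (r:ℝ) * (1 + r) = r + r ^ 2 by ring] at h
  refine (congrArg (fun f => HasSum f _) (funext fun n => ?_)).mpr h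
  rw [Nat.factorial_succ]
  push_cast
  field_simp
  ring

lemma poisson_moments {Ω : Type*} {m0 : MeasurableSpace Ω} {P : Measure Ω} {ν : Ω → ℝ}
    (hν : Measurable ν) {r : NNReal}
    (h : Measure.map ν P = Measure.map (fun k : ℕ => (k : ℝ)) (poissonMeasure r)) :
    MemLp ν 2 P ∧ ∫ ω, ν ω ∂P = r ∧ ∫ ω, ν ω ^ 2 ∂P = r + r ^ 2 := by
  have hc : Measurable (fun k : ℕ => (k : ℝ)) := .of_discrete
  have hi : Integrable (fun k : ℕ => (k : ℝ) ^ 2) (poissonMeasure r) := by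
    rw [integrable_poissonMeasure_iff]
    simpa using (poisson_hasSum_two r).summable
  refine ⟨?_, ?_, ?_⟩
  · rw [memLp_two_iff_integrable_sq hν.aestronglyMeasurable]
    have h2 : Integrable (fun x : ℝ => x ^ 2) (Measure.map ν P) := by
      rw [h, integrable_map_measure (by fun_prop) hc.aemeasurable]
      exact hi
    rw [integrable_map_measure (by fun_prop) hν.aemeasurable] at h2
    exact h2
  · have h3 := integral_map (μ := P) hν.aemeasurable (f := fun x : ℝ => x) (by fun_prop)
    rw [← h3, h, integral_map hc.aemeasurable (by fun_prop), integral_poissonMeasure]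
    simpa using (poisson_hasSum_one r).tsum_eq
  · have h3 := integral_map (μ := P) hν.aemeasurable (f := fun x : ℝ => x ^ 2) (by fun_prop)
    rw [← h3, h, integral_map hc.aemeasurable (by fun_prop), integral_poissonMeasure]
    simpa using (poisson_hasSum_two r).tsum_eq

lemma gauss_moments {Ω : Type*} {m0 : MeasurableSpace Ω} {P : Measure Ω} {w : Ω → ℝ}
    (hw : Measurable w) {v : NNReal}
    (h : Measure.map w P = gaussianReal 0 v) :
    MemLp w 2 P ∧ ∫ ω, w ω ∂P = 0 ∧ ∫ ω, w ω ^ 2 ∂P = v := by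
  have h0 : MemLp id 2 (gaussianReal 0 v) := memLp_id_gaussianReal' 2 (by simp)
  refine ⟨?_, ?_, ?_⟩
  · rw [← h, memLp_map_measure_iff (by fun_prop) hw.aemeasurable] at h0
    exact h0
  · have h3 := integral_map (μ := P) hw.aemeasurable (f := fun x : ℝ => x) (by fun_prop)
    rw [← h3, h, integral_id_gaussianReal]
  · have h3 := integral_map (μ := P) hw.aemeasurable (f := fun x : ℝ => x ^ 2) (by fun_prop)
    rw [← h3, h]
    have h4 := variance_eq_sub h0
    rw [variance_id_gaussianReal] at h4
    simp only [id, Pi.pow_apply, integral_id_gaussianReal] at h4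
    simpa using h4.symm

lemma memLp_growth {Ω : Type*} {m0 : MeasurableSpace Ω} {P : Measure Ω} [IsProbabilityMeasure P]
    {X : Ω → ℝ} (hXm : Measurable X) (hX : MemLp X 2 P) {f : ℝ → ℝ} (hf : Measurable f)
    {K : ℝ} (hK : ∀ x, f x ^ 2 ≤ K * (1 + x ^ 2)) :
    MemLp (fun ω => f (X ω)) 2 P ∧ ∫ ω, f (X ω) ^ 2 ∂P ≤ K * (1 + ∫ ω, X ω ^ 2 ∂P) := by
  have hfm : Measurable (fun ω => f (X ω)) := hf.comp hXm
  have hi : Integrable (fun ω => K * (1 + X ω ^ 2)) P :=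
    ((integrable_const 1).add hX.integrable_sq).const_mul K
  have hm : MemLp (fun ω => f (X ω)) 2 P := by
    rw [memLp_two_iff_integrable_sq hfm.aestronglyMeasurable]
    refine hi.mono' (hfm.pow_const 2).aestronglyMeasurable (.of_forall fun ω => ?_)
    rw [Real.norm_eq_abs, abs_of_nonneg (sq_nonneg _)]
    exact hK _
  refine ⟨hm, ?_⟩
  calc ∫ ω, f (X ω) ^ 2 ∂P ≤ ∫ ω, K * (1 + X ω ^ 2) ∂P :=
        integral_mono hm.integrable_sq hi (fun ω => hK _)
    _ = _ := by
        rw [integral_const_mul, integral_add (integrable_const 1) hX.integrable_sq]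
        simp

lemma memLp_mul_indep {Ω : Type*} {m0 : MeasurableSpace Ω} {P : Measure Ω}
    {S w : Ω → ℝ} (hSm : Measurable S) (hwm : Measurable w)
    (hS : MemLp S 2 P) (hw : MemLp w 2 P) (hi : IndepFun S w P) :
    MemLp (fun ω => S ω * w ω) 2 P ∧
      ∫ ω, (S ω * w ω) ^ 2 ∂P = (∫ ω, S ω ^ 2 ∂P) * ∫ ω, w ω ^ 2 ∂P := by
  have hi2 : IndepFun (fun ω => S ω ^ 2) (fun ω => w ω ^ 2) P :=
    hi.comp (φ := fun x => x ^ 2) (ψ := fun x => x ^ 2) (by fun_prop) (by fun_prop)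
  constructor
  · refine (memLp_two_iff_integrable_sq (hSm.mul hwm).aestronglyMeasurable).2 ?_
    have := hi2.integrable_mul hS.integrable_sq hw.integrable_sq
    refine this.congr (.of_forall fun ω => ?_)
    simp [mul_pow]
  · rw [← hi2.integral_fun_mul_eq_mul_integral (by fun_prop) (by fun_prop)]
    simp [mul_pow]

/-- second moment of the increment -/
lemma em_incr {Ω : Type*} {m0 : MeasurableSpace Ω} {P : Measure Ω} [IsProbabilityMeasure P]
    {X w ν : Ω → ℝ} (hXm : Measurable X) (hwm : Measurable w) (hνm : Measurable ν)
    (hX : MemLp X 2 P) (hw : MemLp w 2 P) (hν : MemLp ν 2 P)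
    (hXw : IndepFun X w P) (hXν : IndepFun X ν P)
    {μ σ ρ : ℝ → ℝ} (hμ : Measurable μ) (hσ : Measurable σ) (hρ : Measurable ρ)
    {K : ℝ} (hK0 : 0 ≤ K) (hKμ : ∀ x, μ x ^ 2 ≤ K * (1 + x ^ 2))
    (hKσ : ∀ x, σ x ^ 2 ≤ K * (1 + x ^ 2)) (hKρ : ∀ x, ρ x ^ 2 ≤ K * (1 + x ^ 2))
    {δ h M : ℝ} (hδ1 : δ ≤ 1) (hh0 : 0 ≤ h) (hh : h ≤ δ)
    (hw2 : ∫ ω, w ω ^ 2 ∂P ≤ δ) (hν2 : ∫ ω, ν ω ^ 2 ∂P ≤ M * δ) :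
    MemLp (fun ω => μ (X ω) * h + σ (X ω) * w ω + ρ (X ω) * ν ω) 2 P ∧
    ∫ ω, (μ (X ω) * h + σ (X ω) * w ω + ρ (X ω) * ν ω) ^ 2 ∂P
      ≤ 3 * K * (2 + M) * δ * (1 + ∫ ω, X ω ^ 2 ∂P) := by
  obtain ⟨lμ, bμ⟩ := memLp_growth hXm hX hμ hKμ
  obtain ⟨lσ, bσ⟩ := memLp_growth hXm hX hσ hKσ
  obtain ⟨lρ, bρ⟩ := memLp_growth hXm hX hρ hKρ
  obtain ⟨lσw, bσw⟩ := memLp_mul_indep (hσ.comp hXm) hwm lσ hw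
    (hXw.comp hσ measurable_id)
  obtain ⟨lρν, bρν⟩ := memLp_mul_indep (hρ.comp hXm) hνm lρ hν
    (hXν.comp hρ measurable_id)
  simp only [Function.comp_apply] at lσw bσw lρν bρν
  have lμh : MemLp (fun ω => μ (X ω) * h) 2 P := lμ.mul_const h
  have l : MemLp (fun ω => μ (X ω) * h + σ (X ω) * w ω + ρ (X ω) * ν ω) 2 P :=
    (lμh.add lσw).add lρν
  refine ⟨l, ?_⟩
  set u := 1 + ∫ ω, X ω ^ 2 ∂P with hu
  have hu0 : 0 ≤ u := by
    have : 0 ≤ ∫ ω, X ω ^ 2 ∂P := integral_nonneg fun ω => sq_nonneg _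
    linarith
  have i1 := lμh.integrable_sq
  have i2 := lσw.integrable_sq
  have i3 := lρν.integrable_sq
  have e1 : ∫ ω, (μ (X ω) * h) ^ 2 ∂P ≤ K * u * δ := by
    simp only [mul_pow]
    rw [integral_mul_const]
    have : h ^ 2 ≤ δ := by nlinarith
    have h0 : 0 ≤ ∫ ω, μ (X ω) ^ 2 ∂P := integral_nonneg fun ω => sq_nonneg _
    gcongr
  have e2 : ∫ ω, (σ (X ω) * w ω) ^ 2 ∂P ≤ K * u * δ := by
    rw [bσw]
    have h0 : 0 ≤ ∫ ω, σ (X ω) ^ 2 ∂P := integral_nonneg fun ω => sq_nonneg _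
    gcongr
  have e3 : ∫ ω, (ρ (X ω) * ν ω) ^ 2 ∂P ≤ K * u * (M * δ) := by
    rw [bρν]
    have h0 : 0 ≤ ∫ ω, ρ (X ω) ^ 2 ∂P := integral_nonneg fun ω => sq_nonneg _
    gcongr
  calc ∫ ω, (μ (X ω) * h + σ (X ω) * w ω + ρ (X ω) * ν ω) ^ 2 ∂P
      ≤ ∫ ω, 3 * ((μ (X ω) * h) ^ 2 + (σ (X ω) * w ω) ^ 2 + (ρ (X ω) * ν ω) ^ 2) ∂P := by
        refine integral_mono l.integrable_sq (((i1.fun_add i2).add i3).const_mul 3) fun ω => ?_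
        dsimp only
        generalize μ (X ω) * h = a
        generalize σ (X ω) * w ω = b
        generalize ρ (X ω) * ν ω = c
        nlinarith [sq_nonneg (a - b), sq_nonneg (a - c), sq_nonneg (b - c)]
    _ = 3 * (∫ ω, (μ (X ω) * h) ^ 2 ∂P + ∫ ω, (σ (X ω) * w ω) ^ 2 ∂P
          + ∫ ω, (ρ (X ω) * ν ω) ^ 2 ∂P) := by
        rw [integral_const_mul, integral_add (i1.fun_add i2) i3, integral_add i1 i2]
    _ ≤ 3 * (K * u * δ + K * u * δ + K * u * (M * δ)) := by gcongr
    _ = _ := by ring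

/-- one step growth of the second moment -/
lemma em_step {Ω : Type*} {m0 : MeasurableSpace Ω} {P : Measure Ω} [IsProbabilityMeasure P]
    {X w ν : Ω → ℝ} (hXm : Measurable X) (hwm : Measurable w) (hνm : Measurable ν)
    (hX : MemLp X 2 P) (hw : MemLp w 2 P) (hν : MemLp ν 2 P)
    (hXw : IndepFun X w P) (hXν : IndepFun X ν P)
    {μ σ ρ : ℝ → ℝ} (hμ : Measurable μ) (hσ : Measurable σ) (hρ : Measurable ρ)
    {K : ℝ} (hK0 : 0 ≤ K) (hKμ : ∀ x, μ x ^ 2 ≤ K * (1 + x ^ 2))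
    (hKσ : ∀ x, σ x ^ 2 ≤ K * (1 + x ^ 2)) (hKρ : ∀ x, ρ x ^ 2 ≤ K * (1 + x ^ 2))
    {δ M : ℝ} (hM : 0 ≤ M) (hδ0 : 0 ≤ δ) (hδ1 : δ ≤ 1)
    (hw1 : ∫ ω, w ω ∂P = 0)
    (hν10 : 0 ≤ ∫ ω, ν ω ∂P) (hν1 : ∫ ω, ν ω ∂P ≤ M * δ)
    (hw2 : ∫ ω, w ω ^ 2 ∂P ≤ δ) (hν2 : ∫ ω, ν ω ^ 2 ∂P ≤ M * δ) :
    1 + ∫ ω, (X ω + μ (X ω) * δ + σ (X ω) * w ω + ρ (X ω) * ν ω) ^ 2 ∂P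
      ≤ (1 + (2 + K + M * (1 + K) + 3 * K * (2 + M)) * δ) * (1 + ∫ ω, X ω ^ 2 ∂P) := by
  obtain ⟨lD, bD⟩ := em_incr hXm hwm hνm hX hw hν hXw hXν hμ hσ hρ hK0 hKμ hKσ hKρ hδ1 hδ0
    le_rfl hw2 hν2
  obtain ⟨lμ, bμ⟩ := memLp_growth hXm hX hμ hKμ
  obtain ⟨lσ, bσ⟩ := memLp_growth hXm hX hσ hKσ
  obtain ⟨lρ, bρ⟩ := memLp_growth hXm hX hρ hKρ
  have iXX := hX.integrable_sq
  have iμμ := lμ.integrable_sq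
  have iρρ := lρ.integrable_sq
  have iDD := lD.integrable_sq
  have iXσ : Integrable (fun ω => X ω * σ (X ω)) P := hX.integrable_mul lσ
  have iXρ : Integrable (fun ω => X ω * ρ (X ω)) P := hX.integrable_mul lρ
  have dw : IndepFun (fun ω => X ω * σ (X ω)) w P :=
    hXw.comp (φ := fun x => x * σ x) (measurable_id.mul hσ) measurable_id
  have dν : IndepFun (fun ω => X ω * ρ (X ω)) ν P :=
    hXν.comp (φ := fun x => x * ρ x) (measurable_id.mul hρ) measurable_id
  have iw := dw.integrable_mul iXσ (hw.integrable one_le_two)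
  have iν := dν.integrable_mul iXρ (hν.integrable one_le_two)
  have ew := dw.integral_fun_mul_eq_mul_integral (by fun_prop) (by fun_prop)
  have eν := dν.integral_fun_mul_eq_mul_integral (by fun_prop) (by fun_prop)
  replace iw : Integrable (fun ω => X ω * σ (X ω) * w ω) P := iw
  replace iν : Integrable (fun ω => X ω * ρ (X ω) * ν ω) P := iν
  rw [hw1, mul_zero] at ew
  set u := 1 + ∫ ω, X ω ^ 2 ∂P with hu
  have hX0 : 0 ≤ ∫ ω, X ω ^ 2 ∂P := integral_nonneg fun ω => sq_nonneg _
  have hu0 : 0 ≤ u := by linarith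
  have eXρ : 2 * ∫ ω, X ω * ρ (X ω) ∂P ≤ (1 + K) * u := by
    calc 2 * ∫ ω, X ω * ρ (X ω) ∂P = ∫ ω, 2 * (X ω * ρ (X ω)) ∂P := by
          rw [integral_const_mul]
      _ ≤ ∫ ω, (X ω ^ 2 + ρ (X ω) ^ 2) ∂P := by
          refine integral_mono (iXρ.const_mul 2) (iXX.fun_add iρρ) fun ω => ?_
          dsimp only
          nlinarith [sq_nonneg (X ω - ρ (X ω))]
      _ = ∫ ω, X ω ^ 2 ∂P + ∫ ω, ρ (X ω) ^ 2 ∂P := integral_add iXX iρρ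
      _ ≤ (1 + K) * u := by linarith
  have eν' : 2 * ∫ ω, X ω * ρ (X ω) * ν ω ∂P ≤ (1 + K) * u * (M * δ) := by
    rw [eν, ← mul_assoc]
    calc _ ≤ (1 + K) * u * ∫ ω, ν ω ∂P := by gcongr
      _ ≤ _ := by gcongr
  calc 1 + ∫ ω, (X ω + μ (X ω) * δ + σ (X ω) * w ω + ρ (X ω) * ν ω) ^ 2 ∂P
      ≤ 1 + ∫ ω, (X ω ^ 2 + δ * (X ω ^ 2 + μ (X ω) ^ 2) + 2 * (X ω * σ (X ω) * w ω)
          + 2 * (X ω * ρ (X ω) * ν ω)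
          + (μ (X ω) * δ + σ (X ω) * w ω + ρ (X ω) * ν ω) ^ 2) ∂P := by
        gcongr 1 + ?_
        refine integral_mono ?_ ((((iXX.fun_add ((iXX.fun_add iμμ).const_mul δ)).fun_add
          (iw.const_mul 2)).fun_add (iν.const_mul 2)).fun_add iDD) fun ω => ?_
        · have := (hX.add lD).integrable_sq
          refine this.congr (.of_forall fun ω => ?_)
          simp only [Pi.add_apply]
          ring
        · dsimp only
          nlinarith [mul_nonneg hδ0 (sq_nonneg (X ω - μ (X ω)))]
    _ = 1 + (∫ ω, X ω ^ 2 ∂P + δ * (∫ ω, X ω ^ 2 ∂P + ∫ ω, μ (X ω) ^ 2 ∂P)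
          + 2 * ∫ ω, X ω * σ (X ω) * w ω ∂P + 2 * ∫ ω, X ω * ρ (X ω) * ν ω ∂P
          + ∫ ω, (μ (X ω) * δ + σ (X ω) * w ω + ρ (X ω) * ν ω) ^ 2 ∂P) := by
        rw [integral_add (((iXX.fun_add ((iXX.fun_add iμμ).const_mul δ)).fun_add
          (iw.const_mul 2)).fun_add (iν.const_mul 2)) iDD,
          integral_add ((iXX.fun_add ((iXX.fun_add iμμ).const_mul δ)).fun_add (iw.const_mul 2))
            (iν.const_mul 2),
          integral_add (iXX.fun_add ((iXX.fun_add iμμ).const_mul δ)) (iw.const_mul 2),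
          integral_add iXX ((iXX.fun_add iμμ).const_mul δ),
          integral_const_mul, integral_add iXX iμμ, integral_const_mul, integral_const_mul]
    _ ≤ 1 + ((u - 1) + δ * (u + K * u) + 2 * 0 + (1 + K) * u * (M * δ)
          + 3 * K * (2 + M) * δ * u) := by
        rw [ew]
        gcongr <;> linarith
    _ ≤ _ := by nlinarith [mul_nonneg hδ0 hu0]

lemma cross_ineq {x z d1 d2 : ℝ} (h : (x - z) * (x + d2 - z) ≤ 0) :
    (x + d1 - z) ^ 2 ≤ 2 * d1 ^ 2 + 2 * d2 ^ 2 := by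
  nlinarith [sq_nonneg (x - z + d2), sq_nonneg (x - z - d1)]

set_option maxHeartbeats 2000000 in
/-- Time-integrated second moment on the crossing event:
`∫_0^T E[1_{Z_k^s} (X^{(δ)}_{s̲+δ} - ζ_k)²] ds ≤ C₃ δ`. -/
theorem em_crossing_second_moment
    {Ω : Type*} {m0 : MeasurableSpace Ω}
    (F : Filtration ℝ m0) (P : Measure Ω) [IsProbabilityMeasure P]
    (T : ℝ) (hT : 0 < T)
    (lam : ℝ → ℝ) (hlam_meas : Measurable lam)
    (hlam_pos : ∀ t ∈ Set.Icc (0:ℝ) T, 0 < lam t)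
    (lamB : ℝ) (hlamB : ∀ t ∈ Set.Icc (0:ℝ) T, lam t ≤ lamB)
    (W N : ℝ → Ω → ℝ)
    (hW0 : ∀ ω, W 0 ω = 0) (hN0 : ∀ ω, N 0 ω = 0)
    (hW_adapted : ∀ t ∈ Set.Icc (0:ℝ) T, Measurable[F t] (W t))
    (hN_adapted : ∀ t ∈ Set.Icc (0:ℝ) T, Measurable[F t] (N t))
    (hW_cont : ∀ᵐ ω ∂P, ContinuousOn (fun t => W t ω) (Set.Icc 0 T))
    (hN_mono : ∀ᵐ ω ∂P, ∀ s t : ℝ, 0 ≤ s → s ≤ t → t ≤ T → N s ω ≤ N t ω)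
    (hN_rc : ∀ᵐ ω ∂P, ∀ t ∈ Set.Ico (0:ℝ) T,
      Filter.Tendsto (fun u => N u ω) (nhdsWithin t (Set.Ioi t)) (nhds (N t ω)))
    (hN_int : ∀ᵐ ω ∂P, ∀ t ∈ Set.Icc (0:ℝ) T, ∃ k : ℕ, N t ω = k)
    (hW_gauss : ∀ s t : ℝ, 0 ≤ s → s ≤ t → t ≤ T →
      Measure.map (fun ω => W t ω - W s ω) P = gaussianReal 0 (Real.toNNReal (t - s)))
    (hN_poisson : ∀ s t : ℝ, 0 ≤ s → s ≤ t → t ≤ T →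
      Measure.map (fun ω => N t ω - N s ω) P
        = Measure.map (fun k : ℕ => (k : ℝ))
            (poissonMeasure (Real.toNNReal (∫ u in s..t, lam u))))
    (h_indep : ∀ s t : ℝ, 0 ≤ s → s ≤ t → t ≤ T →
      Indep (MeasurableSpace.comap (fun ω => (W t ω - W s ω, N t ω - N s ω)) inferInstance)
        (F s) P)
    (hWN_indep : ∀ s t : ℝ, 0 ≤ s → s ≤ t → t ≤ T →
      IndepFun (fun ω => W t ω - W s ω) (fun ω => N t ω - N s ω) P)
    (μ σ ρ : ℝ → ℝ) (hμ_meas : Measurable μ) (hσ_meas : Measurable σ) (hρ_meas : Measurable ρ)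
    (m : ℕ) (hm : 0 < m) (ζ : Fin m → ℝ) (hζ : StrictMono ζ)
    (hμ_low : ∃ K : NNReal, LipschitzOnWith K μ (Set.Iio (ζ ⟨0, hm⟩)))
    (hμ_high : ∃ K : NNReal, LipschitzOnWith K μ (Set.Ioi (ζ ⟨m - 1, Nat.sub_lt hm one_pos⟩)))
    (hμ_mid : ∀ (k : Fin m) (h : (k : ℕ) + 1 < m),
      ∃ K : NNReal, LipschitzOnWith K μ (Set.Ioo (ζ k) (ζ ⟨(k : ℕ) + 1, h⟩)))
    (hσ_lip : ∃ K : NNReal, LipschitzWith K σ)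
    (hσ_nz : ∀ k : Fin m, σ (ζ k) ≠ 0)
    (hρ_lip : ∃ K : NNReal, LipschitzWith K ρ)
    (ξ : ℝ) :
    ∃ C : ℝ, 0 < C ∧ ∀ n : ℕ, 0 < n → T / n < 1 → ∀ k : Fin m,
      ∫⁻ s in Set.Ico (0:ℝ) T,
          ∫⁻ ω in crossEvent μ σ ρ W N (T / n) ξ (ζ k) s,
            ENNReal.ofReal
              ((emProc μ σ ρ W N (T / n) ξ (lastGrid (T / n) s + T / n) ω - ζ k) ^ 2) ∂P
        ≤ ENNReal.ofReal (C * (T / n)) := by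
  classical
  obtain ⟨Kμ, hKμ0, hKμ⟩ := growthOn_sq (growth_piecewise m hm ζ hμ_low hμ_high hμ_mid)
  obtain ⟨Kσ, hKσ0, hKσ⟩ := growthOn_sq (f := σ) (growthOn_of_lipschitzOn
    (hσ_lip.imp fun K h => h.lipschitzOnWith))
  obtain ⟨Kρ, hKρ0, hKρ⟩ := growthOn_sq (f := ρ) (growthOn_of_lipschitzOn
    (hρ_lip.imp fun K h => h.lipschitzOnWith))
  obtain ⟨K, hK0, hKμ', hKσ', hKρ'⟩ : ∃ K : ℝ, 0 ≤ K ∧ (∀ x, μ x ^ 2 ≤ K * (1 + x ^ 2)) ∧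
      (∀ x, σ x ^ 2 ≤ K * (1 + x ^ 2)) ∧ (∀ x, ρ x ^ 2 ≤ K * (1 + x ^ 2)) := by
    refine ⟨Kμ + Kσ + Kρ, by positivity, fun x => (hKμ x).trans ?_, fun x => (hKσ x).trans ?_,
      fun x => (hKρ x).trans ?_⟩ <;> gcongr <;> linarith
  have hL0 : 0 ≤ lamB := ((hlam_pos 0 ⟨le_rfl, hT.le⟩).le).trans (hlamB 0 ⟨le_rfl, hT.le⟩)
  set M : ℝ := lamB + lamB ^ 2 with hM
  have hM0 : 0 ≤ M := by positivity
  set A : ℝ := 2 + K + M * (1 + K) + 3 * K * (2 + M) with hA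
  have hA0 : 0 ≤ A := by positivity
  set U : ℝ := Real.exp (A * T) * (1 + ξ ^ 2) with hU
  have hU0 : 0 ≤ U := by positivity
  refine ⟨4 * (3 * K * (2 + M)) * U * T + 1, by positivity, ?_⟩
  intro n hn hδ1 k
  have hn' : (0:ℝ) < n := by exact_mod_cast hn
  set δ : ℝ := T / n with hδ
  have hδ0 : 0 < δ := by positivity
  have hnδ : n * δ = T := by rw [hδ]; field_simp
  -- measurability and moments of increments
  have hWm : ∀ t ∈ Set.Icc (0:ℝ) T, Measurable (W t) := fun t ht =>
    (hW_adapted t ht).mono (F.le t) le_rfl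
  have hNm : ∀ t ∈ Set.Icc (0:ℝ) T, Measurable (N t) := fun t ht =>
    (hN_adapted t ht).mono (F.le t) le_rfl
  have hincW : ∀ s t : ℝ, 0 ≤ s → s ≤ t → t ≤ T → t - s ≤ δ →
      Measurable (fun ω => W t ω - W s ω) ∧ MemLp (fun ω => W t ω - W s ω) 2 P ∧
      ∫ ω, (W t ω - W s ω) ∂P = 0 ∧ ∫ ω, (W t ω - W s ω) ^ 2 ∂P ≤ δ := by
    intro s t hs hst ht hd
    have hm' : Measurable (fun ω => W t ω - W s ω) :=
      (hWm t ⟨hs.trans hst, ht⟩).sub (hWm s ⟨hs, hst.trans ht⟩)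
    obtain ⟨a, b, c⟩ := gauss_moments hm' (hW_gauss s t hs hst ht)
    refine ⟨hm', a, b, ?_⟩
    rw [c, Real.coe_toNNReal _ (by linarith)]
    exact hd
  have hincN : ∀ s t : ℝ, 0 ≤ s → s ≤ t → t ≤ T → t - s ≤ δ →
      Measurable (fun ω => N t ω - N s ω) ∧ MemLp (fun ω => N t ω - N s ω) 2 P ∧
      0 ≤ ∫ ω, (N t ω - N s ω) ∂P ∧ ∫ ω, (N t ω - N s ω) ∂P ≤ M * δ ∧
      ∫ ω, (N t ω - N s ω) ^ 2 ∂P ≤ M * δ := by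
    intro s t hs hst ht hd
    have hm' : Measurable (fun ω => N t ω - N s ω) :=
      (hNm t ⟨hs.trans hst, ht⟩).sub (hNm s ⟨hs, hst.trans ht⟩)
    obtain ⟨a, b, c⟩ := poisson_moments hm' (hN_poisson s t hs hst ht)
    have h1 : ‖∫ u in s..t, lam u‖ ≤ lamB * |t - s| := by
      refine intervalIntegral.norm_integral_le_of_norm_le_const fun x hx => ?_
      rw [Set.uIoc_of_le hst] at hx
      have hx' : x ∈ Set.Icc (0:ℝ) T := ⟨hs.trans hx.1.le, hx.2.trans ht⟩
      rw [Real.norm_eq_abs, abs_of_pos (hlam_pos x hx')]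
      exact hlamB x hx'
    set r := Real.toNNReal (∫ u in s..t, lam u) with hr
    have hr1 : (r:ℝ) ≤ lamB * δ := by
      rw [hr, Real.coe_toNNReal']
      have h2 : |t - s| ≤ δ := by rwa [abs_of_nonneg (by linarith)]
      have h3 : lamB * |t - s| ≤ lamB * δ := by gcongr
      refine max_le ?_ (by positivity)
      exact (le_abs_self _).trans (h1.trans h3)
    have hr0 : (0:ℝ) ≤ r := r.2
    have hr2 : (r:ℝ) ^ 2 ≤ lamB ^ 2 * δ := by
      calc (r:ℝ) ^ 2 ≤ (lamB * δ) ^ 2 := by gcongr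
        _ = lamB ^ 2 * (δ * δ) := by ring
        _ ≤ lamB ^ 2 * (1 * δ) := by gcongr
        _ = _ := by ring
    have hl2 : 0 ≤ lamB ^ 2 * δ := by positivity
    refine ⟨hm', a, by rw [b]; exact hr0, ?_, ?_⟩
    · rw [b, hM]; linarith
    · rw [c, hM]; linarith
  have hind : ∀ s t : ℝ, 0 ≤ s → s ≤ t → t ≤ T → ∀ X : Ω → ℝ, Measurable[F s] X →
      IndepFun X (fun ω => W t ω - W s ω) P ∧ IndepFun X (fun ω => N t ω - N s ω) P := by
    intro s t hs hst ht X hX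
    have h0 := (h_indep s t hs hst ht).symm
    have h1 : IndepFun X (fun ω => (W t ω - W s ω, N t ω - N s ω)) P := by
      rw [IndepFun_iff_Indep]
      exact indep_of_indep_of_le_left h0 hX.comap_le
    exact ⟨h1.comp measurable_id measurable_fst, h1.comp measurable_id measurable_snd⟩
  -- the grid
  have hjT : ∀ j : ℕ, j ≤ n → (j:ℝ) * δ ∈ Set.Icc (0:ℝ) T := by
    intro j hj
    refine ⟨by positivity, ?_⟩
    rw [← hnδ]
    gcongr
  have hgrid : ∀ j : ℕ, j ≤ n → Measurable[F ((j:ℝ) * δ)] (emGrid μ σ ρ W N δ ξ j) ∧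
      MemLp (emGrid μ σ ρ W N δ ξ j) 2 P ∧
      1 + ∫ ω, emGrid μ σ ρ W N δ ξ j ω ^ 2 ∂P ≤ (1 + A * δ) ^ j * (1 + ξ ^ 2) := by
    intro j
    induction j with
    | zero =>
      intro _
      have : emGrid μ σ ρ W N δ ξ 0 = fun _ => ξ := by
        funext ω; rfl
      rw [this]
      refine ⟨measurable_const, memLp_const ξ, ?_⟩
      simp
    | succ j ih =>
      intro hj
      obtain ⟨hX, hXl, hXb⟩ := ih (by omega)
      have hs := hjT j (by omega)
      have ht := hjT (j + 1) hj
      push_cast at ht ⊢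
      have hst : (j:ℝ) * δ ≤ ((j:ℝ) + 1) * δ := by nlinarith
      have hd : ((j:ℝ) + 1) * δ - (j:ℝ) * δ ≤ δ := by linarith
      obtain ⟨w1, w2, w3, w4⟩ := hincW _ _ hs.1 hst ht.2 hd
      obtain ⟨n1, n2, n3, n4, n5⟩ := hincN _ _ hs.1 hst ht.2 hd
      obtain ⟨iw, iN⟩ := hind _ _ hs.1 hst ht.2 _ hX
      have hXm : Measurable (emGrid μ σ ρ W N δ ξ j) := hX.mono (F.le _) le_rfl
      have heq : emGrid μ σ ρ W N δ ξ (j + 1) = fun ω =>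
        emGrid μ σ ρ W N δ ξ j ω
        + μ (emGrid μ σ ρ W N δ ξ j ω) * δ
        + σ (emGrid μ σ ρ W N δ ξ j ω) * (W (((j : ℝ) + 1) * δ) ω - W ((j : ℝ) * δ) ω)
        + ρ (emGrid μ σ ρ W N δ ξ j ω) * (N (((j : ℝ) + 1) * δ) ω - N ((j : ℝ) * δ) ω) := by
        funext ω; rfl
      rw [heq]
      refine ⟨?_, ?_, ?_⟩
      · have hF := F.mono hst
        have hX' := hX.mono hF le_rfl
        have a1 := hW_adapted _ ht
        have a2 := (hW_adapted _ hs).mono hF le_rfl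
        have a3 := hN_adapted _ ht
        have a4 := (hN_adapted _ hs).mono hF le_rfl
        rw [Nat.cast_succ]
        exact ((hX'.add ((hμ_meas.comp hX').mul_const δ)).add
          ((hσ_meas.comp hX').mul (a1.sub a2))).add ((hρ_meas.comp hX').mul (a3.sub a4))
      · have := (em_incr hXm w1 n1 hXl w2 n2 iw iN hμ_meas hσ_meas hρ_meas hK0 hKμ' hKσ' hKρ'
          hδ1.le hδ0.le le_rfl w4 n5).1
        refine (hXl.add this).ae_eq (.of_forall fun ω => ?_)
        simp only [Pi.add_apply]
        ring
      · refine (em_step hXm w1 n1 hXl w2 n2 iw iN hμ_meas hσ_meas hρ_meas hK0 hKμ' hKσ' hKρ' hM0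
          hδ0.le hδ1.le w3 n3 n4 w4 n5).trans ?_
        rw [← hA, pow_succ', mul_assoc]
        gcongr
  have hgridU : ∀ j : ℕ, j ≤ n → 1 + ∫ ω, emGrid μ σ ρ W N δ ξ j ω ^ 2 ∂P ≤ U := by
    intro j hj
    refine (hgrid j hj).2.2.trans ?_
    rw [hU]
    gcongr
    calc (1 + A * δ) ^ j ≤ (Real.exp (A * δ)) ^ j := by
          gcongr
          linarith [Real.add_one_le_exp (A * δ)]
      _ = Real.exp (A * (j * δ)) := by rw [← Real.exp_nat_mul]; ring_nf
      _ ≤ _ := by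
          gcongr
          exact (hjT j hj).2
  -- bound for each time
  have hmain : ∀ s ∈ Set.Ico (0:ℝ) T,
      ∫⁻ ω in crossEvent μ σ ρ W N δ ξ (ζ k) s,
        ENNReal.ofReal ((emProc μ σ ρ W N δ ξ (lastGrid δ s + δ) ω - ζ k) ^ 2) ∂P
      ≤ ENNReal.ofReal (4 * (3 * K * (2 + M)) * U * δ) := by
    intro s hs
    obtain ⟨j, hj⟩ : ∃ j : ℕ, j = ⌊s / δ⌋.toNat := ⟨_, rfl⟩
    have hsd : 0 ≤ s / δ := div_nonneg hs.1 hδ0.le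
    have hjz : (j : ℤ) = ⌊s / δ⌋ := by rw [hj]; exact Int.toNat_of_nonneg (Int.floor_nonneg.2 hsd)
    have hjr : (j : ℝ) = (⌊s / δ⌋ : ℝ) := by exact_mod_cast congrArg (Int.cast (R := ℝ)) hjz
    have hj1 : (j:ℝ) * δ ≤ s := by
      rw [← le_div_iff₀ hδ0, hjr]; exact Int.floor_le _
    have hj2 : s < ((j:ℝ) + 1) * δ := by
      rw [← div_lt_iff₀ hδ0, hjr]; exact Int.lt_floor_add_one _
    have hjn : j + 1 ≤ n := by
      have h1 : (j:ℝ) * δ < n * δ := by rw [hnδ]; exact hj1.trans_lt hs.2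
      have h2 : (j:ℝ) < n := lt_of_mul_lt_mul_right h1 hδ0.le
      have : j < n := by exact_mod_cast h2
      omega
    have hlast : lastGrid δ s = j * δ := by rw [lastGrid, hj]
    have hfl : ∀ i : ℕ, ⌊(i:ℝ) * δ / δ⌋.toNat = i := by
      intro i
      rw [mul_div_cancel_right₀ _ hδ0.ne']
      simp
    have hproc : ∀ i : ℕ, ∀ ω, emProc μ σ ρ W N δ ξ ((i:ℝ) * δ) ω = emGrid μ σ ρ W N δ ξ i ω := by
      intro i ω
      simp only [emProc, lastGrid, hfl]
      ring
    have hprocs : ∀ ω, emProc μ σ ρ W N δ ξ s ω = emGrid μ σ ρ W N δ ξ j ω +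
        (μ (emGrid μ σ ρ W N δ ξ j ω) * (s - j * δ)
        + σ (emGrid μ σ ρ W N δ ξ j ω) * (W s ω - W (j * δ) ω)
        + ρ (emGrid μ σ ρ W N δ ξ j ω) * (N s ω - N (j * δ) ω)) := by
      intro ω
      simp only [emProc, hlast, ← hj]
      ring
    have hnext : ∀ ω, emProc μ σ ρ W N δ ξ (lastGrid δ s + δ) ω = emGrid μ σ ρ W N δ ξ j ω +
        (μ (emGrid μ σ ρ W N δ ξ j ω) * δ
        + σ (emGrid μ σ ρ W N δ ξ j ω) * (W (((j:ℝ) + 1) * δ) ω - W (j * δ) ω)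
        + ρ (emGrid μ σ ρ W N δ ξ j ω) * (N (((j:ℝ) + 1) * δ) ω - N (j * δ) ω)) := by
      intro ω
      have : lastGrid δ s + δ = ((j + 1 : ℕ) : ℝ) * δ := by rw [hlast]; push_cast; ring
      rw [this, hproc, emGrid]
      ring
    obtain ⟨hX, hXl, -⟩ := hgrid j (by omega)
    have hXU := hgridU j (by omega)
    have hXm : Measurable (emGrid μ σ ρ W N δ ξ j) := hX.mono (F.le _) le_rfl
    have hs0 := hjT j (by omega)
    have ht := hjT (j + 1) hjn
    push_cast at ht
    have hst : (j:ℝ) * δ ≤ ((j:ℝ) + 1) * δ := by nlinarith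
    have hd : ((j:ℝ) + 1) * δ - (j:ℝ) * δ ≤ δ := by linarith
    have hd' : s - (j:ℝ) * δ ≤ δ := by linarith
    obtain ⟨w1, w2, w3, w4⟩ := hincW _ _ hs0.1 hst ht.2 hd
    obtain ⟨n1, n2, n3, n4, n5⟩ := hincN _ _ hs0.1 hst ht.2 hd
    obtain ⟨iw, iN⟩ := hind _ _ hs0.1 hst ht.2 _ hX
    obtain ⟨w1', w2', w3', w4'⟩ := hincW _ _ hs0.1 hj1 hs.2.le hd'
    obtain ⟨n1', n2', n3', n4', n5'⟩ := hincN _ _ hs0.1 hj1 hs.2.le hd'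
    obtain ⟨iw', iN'⟩ := hind _ _ hs0.1 hj1 hs.2.le _ hX
    obtain ⟨l1, b1⟩ := em_incr hXm w1 n1 hXl w2 n2 iw iN hμ_meas hσ_meas hρ_meas hK0 hKμ' hKσ'
      hKρ' hδ1.le hδ0.le le_rfl w4 n5
    obtain ⟨l2, b2⟩ := em_incr hXm w1' n1' hXl w2' n2' iw' iN' hμ_meas hσ_meas hρ_meas hK0 hKμ'
      hKσ' hKρ' hδ1.le (sub_nonneg.2 hj1) hd' w4' n5'
    have hmeasD : ∀ (h : ℝ) (w ν : Ω → ℝ), Measurable w → Measurable ν → Measurable (fun ω =>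
        μ (emGrid μ σ ρ W N δ ξ j ω) * h + σ (emGrid μ σ ρ W N δ ξ j ω) * w ω
          + ρ (emGrid μ σ ρ W N δ ξ j ω) * ν ω) := fun h w ν hw hν =>
      (((hμ_meas.comp hXm).mul_const h).add ((hσ_meas.comp hXm).mul hw)).add
        ((hρ_meas.comp hXm).mul hν)
    have m1 := hmeasD δ _ _ w1 n1
    have m2 := hmeasD (s - j * δ) _ _ w1' n1'
    set D1 : Ω → ℝ := fun ω => μ (emGrid μ σ ρ W N δ ξ j ω) * δ
        + σ (emGrid μ σ ρ W N δ ξ j ω) * (W (((j:ℝ) + 1) * δ) ω - W (j * δ) ω)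
        + ρ (emGrid μ σ ρ W N δ ξ j ω) * (N (((j:ℝ) + 1) * δ) ω - N (j * δ) ω) with hD1
    set D2 : Ω → ℝ := fun ω => μ (emGrid μ σ ρ W N δ ξ j ω) * (s - j * δ)
        + σ (emGrid μ σ ρ W N δ ξ j ω) * (W s ω - W (j * δ) ω)
        + ρ (emGrid μ σ ρ W N δ ξ j ω) * (N s ω - N (j * δ) ω) with hD2
    have hB0 : 0 ≤ 3 * K * (2 + M) * δ := by positivity
    have b1' : ∫ ω, D1 ω ^ 2 ∂P ≤ 3 * K * (2 + M) * δ * U :=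
      b1.trans (mul_le_mul_of_nonneg_left hXU hB0)
    have b2' : ∫ ω, D2 ω ^ 2 ∂P ≤ 3 * K * (2 + M) * δ * U :=
      b2.trans (mul_le_mul_of_nonneg_left hXU hB0)
    have i1 : Integrable (fun ω => 2 * D1 ω ^ 2) P := l1.integrable_sq.const_mul 2
    have i2 : Integrable (fun ω => 2 * D2 ω ^ 2) P := l2.integrable_sq.const_mul 2
    calc ∫⁻ ω in crossEvent μ σ ρ W N δ ξ (ζ k) s,
          ENNReal.ofReal ((emProc μ σ ρ W N δ ξ (lastGrid δ s + δ) ω - ζ k) ^ 2) ∂P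
        ≤ ∫⁻ ω in crossEvent μ σ ρ W N δ ξ (ζ k) s,
          ENNReal.ofReal (2 * D1 ω ^ 2 + 2 * D2 ω ^ 2) ∂P := by
          refine setLIntegral_mono ?_ fun ω hω => ?_
          · exact (((m1.pow_const 2).const_mul 2).add ((m2.pow_const 2).const_mul 2)).ennreal_ofReal
          · apply ENNReal.ofReal_le_ofReal
            have h1 : (emProc μ σ ρ W N δ ξ (lastGrid δ s) ω - ζ k) *
              (emProc μ σ ρ W N δ ξ s ω - ζ k) ≤ 0 := hω
            rw [hlast, hproc, hprocs] at h1
            rw [hnext]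
            change (emGrid μ σ ρ W N δ ξ j ω - ζ k) *
              (emGrid μ σ ρ W N δ ξ j ω + D2 ω - ζ k) ≤ 0 at h1
            change (emGrid μ σ ρ W N δ ξ j ω + D1 ω - ζ k) ^ 2 ≤ _
            generalize emGrid μ σ ρ W N δ ξ j ω = x at h1 ⊢
            generalize D1 ω = d1
            generalize D2 ω = d2 at h1 ⊢
            exact cross_ineq h1
      _ ≤ ∫⁻ ω, ENNReal.ofReal (2 * D1 ω ^ 2 + 2 * D2 ω ^ 2) ∂P := setLIntegral_le_lintegral _ _
      _ = ENNReal.ofReal (∫ ω, (2 * D1 ω ^ 2 + 2 * D2 ω ^ 2) ∂P) := by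
          rw [ofReal_integral_eq_lintegral_ofReal (i1.fun_add i2)
            (.of_forall fun ω => by dsimp only [Pi.zero_apply]; positivity)]
      _ ≤ _ := by
          apply ENNReal.ofReal_le_ofReal
          rw [integral_add i1 i2, integral_const_mul, integral_const_mul]
          linarith
  calc _ ≤ ∫⁻ s in Set.Ico (0:ℝ) T, ENNReal.ofReal (4 * (3 * K * (2 + M)) * U * δ) :=
        setLIntegral_mono' measurableSet_Ico hmain
    _ = ENNReal.ofReal (4 * (3 * K * (2 + M)) * U * δ) * ENNReal.ofReal T := by
        rw [setLIntegral_const, Real.volume_Ico, sub_zero]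
    _ = ENNReal.ofReal (4 * (3 * K * (2 + M)) * U * δ * T) := by
        exact (ENNReal.ofReal_mul (by positivity)).symm
    _ ≤ _ := by
        apply ENNReal.ofReal_le_ofReal
        linarith
end
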